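/- arXiv:2207.04741 — 3 statements merged into one kernel-verified Lean document; each statement's English description precedes it below -/
import Mathlib

section
/- Let 1/2 < s < 1. Let δ_n be a positive sequence with δ_n → 0, set Λ_n = 1/δ_n, let T_n = L_n(Λ_n+1)δ_n with L_n a positive integer, and let u_n be a minimizer of ℱ^{T_n}_s over 𝒜^{T_n,Λ_n,δ_n}. Then lim_{n→∞} ℱ^{T_n}_s(u_n) / σ_n = 1, where σ_n = δ_n^{1−2s} / (2s(1−s)(2s−1)(3−2s)). -/
open MeasureTheory Filter Set Topology

noncomputable section

/-- A function `u : ℝ → ℝ` is piecewise affine: it is affine in a neighborhood of every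
point outside a closed discrete set (the corner set). -/
def PiecewiseAffine (u : ℝ → ℝ) : Prop :=
  ∃ S : Set ℝ, IsClosed S ∧ (∀ x ∈ S, ∃ ε > 0, S ∩ Set.Ioo (x - ε) (x + ε) ⊆ {x}) ∧
    ∀ x ∉ S, ∃ ε > 0, ∃ m q : ℝ, ∀ y : ℝ, |y - x| < ε → u y = m * y + q

/-- The admissible class `𝒜^{T,Λ,δ}`: continuous, `T`-periodic, piecewise affine functions
with slope in `{1, -Λ}` a.e., such that the region where the slope is `-Λ` is a union of
intervals of length `δ` whose pairwise intersections contain at most one point. -/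
structure Admissible (T Λ δ : ℝ) (u : ℝ → ℝ) : Prop where
  cont : Continuous u
  per : Function.Periodic u T
  pwAffine : PiecewiseAffine u
  slopes : ∀ᵐ x : ℝ ∂volume, HasDerivAt u 1 x ∨ HasDerivAt u (-Λ) x
  negRegion : ∃ a : ℕ → ℝ,
    (∀ k : ℕ, Set.Ioo (a k) (a k + δ) ⊆ {x : ℝ | HasDerivAt u (-Λ) x}) ∧
    ({x : ℝ | HasDerivAt u (-Λ) x} ⊆ ⋃ k : ℕ, Set.Icc (a k) (a k + δ)) ∧
    (Pairwise fun i j : ℕ =>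
      (Set.Icc (a i) (a i + δ) ∩ Set.Icc (a j) (a j + δ)).Subsingleton)

/-- The `s`-fractional Gagliardo seminorm energy density
`ℱ^T_s(u) = (1/(2T)) ∫_0^T ∫_ℝ |u(x)-u(y)|²/|x-y|^{1+2s} dy dx`. -/
def Fs (s T : ℝ) (u : ℝ → ℝ) : ℝ :=
  (1 / (2 * T)) * ∫ x in Set.Ioo (0 : ℝ) T, ∫ y : ℝ, (u x - u y) ^ 2 / |x - y| ^ (1 + 2 * s)

/-- The `s`-fractional Laplacian
`(-Δ)^s u (x) = 2 lim_{r→0⁺} ∫_{ℝ∖(x-r,x+r)} (u(x)-u(y))/|x-y|^{1+2s} dy`. -/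
def fracLap (s : ℝ) (u : ℝ → ℝ) (x : ℝ) : ℝ :=
  limUnder (𝓝[>] (0 : ℝ)) fun r : ℝ =>
    2 * ∫ y in {y : ℝ | r ≤ |x - y|}, (u x - u y) / |x - y| ^ (1 + 2 * s)

/-- The function `ū`: the `(Λ+1)δ`-periodic function equal to `-Λx` on `(-δ,0)` and to
`x` on `[0,Λδ]`. -/
def ubar (Λ δ : ℝ) (x : ℝ) : ℝ :=
  let y := ((Λ + 1) * δ) * Int.fract ((x + δ) / ((Λ + 1) * δ)) - δ
  if y < 0 then -Λ * y else y

/-- The extremal energy for `s = 0`: `ℱ^T_0(u) = (1/(2T)) ∫_0^T |u(x)|² dx`. -/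
def F0 (T : ℝ) (u : ℝ → ℝ) : ℝ :=
  (1 / (2 * T)) * ∫ x in Set.Ioo (0 : ℝ) T, (u x) ^ 2

/-- The extremal energy for `s = 1`: `ℱ^T_1(u) = (1/(2T)) ∫_0^T |u'(x)|² dx`. -/
def F1 (T : ℝ) (u : ℝ → ℝ) : ℝ :=
  (1 / (2 * T)) * ∫ x in Set.Ioo (0 : ℝ) T, (deriv u x) ^ 2

/-- The integral over one period of the squared increment of `u` with step `h`. -/
def sqIncr (u : ℝ → ℝ) (T h : ℝ) : ℝ :=
  ∫ x in (0 : ℝ)..T, (u (x + h) - u x) ^ 2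

lemma sqIncr_neg {u : ℝ → ℝ} {T : ℝ} (hper : Function.Periodic u T) (h : ℝ) :
    sqIncr u T (-h) = sqIncr u T h := by
  have hF : Function.Periodic (fun x => (u (x + -h) - u x) ^ 2) T := by
    intro x
    simp only
    rw [show x + T + -h = x + -h + T by ring, hper, hper]
  have h1 := hF.intervalIntegral_add_eq 0 h
  unfold sqIncr
  rw [zero_add] at h1
  rw [h1]
  have h2 := intervalIntegral.integral_comp_add_right (a := 0) (b := T)
    (fun x => (u (x + -h) - u x) ^ 2) h
  rw [zero_add, add_comm T h] at h2
  rw [← h2]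
  refine intervalIntegral.integral_congr fun x _ => ?_
  simp only [add_neg_cancel_right]
  ring

lemma sqIncr_abs {u : ℝ → ℝ} {T : ℝ} (hper : Function.Periodic u T) (h : ℝ) :
    sqIncr u T |h| = sqIncr u T h := by
  rcases abs_choice h with h' | h' <;> rw [h']
  exact sqIncr_neg hper h

lemma integrable_of_even {f : ℝ → ℝ} (hf : ∀ x, f (-x) = f x)
    (hi : IntegrableOn f (Ioi 0)) : Integrable f := by
  rw [← integrableOn_univ, ← Iic_union_Ioi (a := (0 : ℝ))]
  refine IntegrableOn.union ?_ hi
  have h2 := (integrableOn_Ici_iff_integrableOn_Ioi (μ := volume)).2 hi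
  rw [show (0 : ℝ) = -0 by simp] at h2
  have h3 := h2.comp_neg_Iic
  simpa only [hf] using h3

lemma integrable_min_div_rpow {s : ℝ} (hs : 0 < s) (hs1 : s < 1) (K : ℝ) {M : ℝ} (hM : 0 ≤ M) :
    Integrable fun h : ℝ => min (K ^ 2 * h ^ 2) M / |h| ^ (1 + 2 * s) := by
  refine integrable_of_even (fun x => by simp) ?_
  rw [← Ioc_union_Ioi_eq_Ioi (zero_le_one (α := ℝ))]
  have hmeas : Measurable fun h : ℝ => min (K ^ 2 * h ^ 2) M / |h| ^ (1 + 2 * s) := by fun_prop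
  have hnn (h : ℝ) : 0 ≤ min (K ^ 2 * h ^ 2) M / |h| ^ (1 + 2 * s) :=
    div_nonneg (le_min (by positivity) hM) (by positivity)
  refine IntegrableOn.union ?_ ?_
  · have h1 : IntegrableOn (fun h : ℝ => K ^ 2 * h ^ (1 - 2 * s)) (Ioc 0 1) :=
      ((intervalIntegrable_iff_integrableOn_Ioc_of_le zero_le_one).1
        (intervalIntegral.intervalIntegrable_rpow' (by linarith))).const_mul _
    refine Integrable.mono' h1 hmeas.aestronglyMeasurable ?_
    refine (ae_restrict_iff' measurableSet_Ioc).2 (Eventually.of_forall fun h hh => ?_)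
    rw [Real.norm_of_nonneg (hnn h), abs_of_pos hh.1, div_le_iff₀ (Real.rpow_pos_of_pos hh.1 _),
      mul_assoc, ← Real.rpow_add hh.1, show 1 - 2 * s + (1 + 2 * s) = (2 : ℕ) by push_cast; ring,
      Real.rpow_natCast]
    exact min_le_left _ _
  · have h1 : IntegrableOn (fun h : ℝ => M * h ^ (-(1 + 2 * s))) (Ioi 1) :=
      (integrableOn_Ioi_rpow_of_lt (by linarith) one_pos).const_mul _
    refine Integrable.mono' h1 hmeas.aestronglyMeasurable ?_
    refine (ae_restrict_iff' measurableSet_Ioi).2 (Eventually.of_forall fun h hh => ?_)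
    have hh0 : 0 < h := one_pos.trans hh
    rw [Real.norm_of_nonneg (hnn h), abs_of_pos hh0, Real.rpow_neg hh0.le, ← div_eq_mul_inv]
    gcongr
    exact min_le_right _ _

lemma integrable_increment {s T K M : ℝ} (hs : 0 < s) (hs1 : s < 1)
    {u : ℝ → ℝ} (hcont : Continuous u) (hK : ∀ x y, |u x - u y| ≤ K * |x - y|)
    (hM : ∀ x y, (u x - u y) ^ 2 ≤ M) :
    Integrable (Function.uncurry fun x h : ℝ => (u (x + h) - u x) ^ 2 / |h| ^ (1 + 2 * s))
      ((volume.restrict (Ioo 0 T)).prod volume) := by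
  have h1 : Integrable (fun _ : ℝ => (1 : ℝ)) (volume.restrict (Ioo (0 : ℝ) T)) :=
    integrable_const _
  refine (h1.mul_prod (integrable_min_div_rpow hs hs1 K ((sq_nonneg _).trans (hM 0 0)))).mono' ?_ ?_
  · refine Measurable.aestronglyMeasurable ?_
    have := hcont.measurable
    unfold Function.uncurry
    fun_prop
  · refine Eventually.of_forall fun ⟨x, h⟩ => ?_
    simp only [Function.uncurry, one_mul]
    rw [Real.norm_of_nonneg (by positivity)]
    gcongr
    refine le_min ?_ (hM _ _)
    rw [← sq_abs (u _ - _), ← sq_abs h, ← mul_pow]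
    gcongr
    simpa using hK (x + h) x

lemma Fs_eq_integral_sqIncr {s T K M : ℝ} (hs : 0 < s) (hs1 : s < 1) (hT : 0 < T)
    {u : ℝ → ℝ} (hcont : Continuous u) (hper : Function.Periodic u T)
    (hK : ∀ x y, |u x - u y| ≤ K * |x - y|) (hM : ∀ x y, (u x - u y) ^ 2 ≤ M) :
    IntegrableOn (fun h => sqIncr u T h / h ^ (1 + 2 * s)) (Ioi 0) ∧
      Fs s T u = 1 / T * ∫ h in Ioi (0 : ℝ), sqIncr u T h / h ^ (1 + 2 * s) := by
  have hint := integrable_increment (T := T) hs hs1 hcont hK hM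
  have hslice (h : ℝ) : ∫ x in Ioo 0 T, (u (x + h) - u x) ^ 2 / |h| ^ (1 + 2 * s) =
      sqIncr u T |h| / |h| ^ (1 + 2 * s) := by
    rw [integral_div, sqIncr_abs hper, sqIncr, intervalIntegral.integral_of_le hT.le,
      integral_Ioc_eq_integral_Ioo]
  constructor
  · have h1 := hint.integral_prod_right.integrableOn (s := Ioi 0)
    refine h1.congr_fun (fun h hh => ?_) measurableSet_Ioi
    simp only [Function.uncurry]
    rw [hslice, abs_of_pos hh]
  · have h2 := integral_comp_abs (f := fun h => sqIncr u T h / h ^ (1 + 2 * s))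
    have h3 : ∫ x in Ioo 0 T, ∫ y, (u x - u y) ^ 2 / |x - y| ^ (1 + 2 * s) =
        ∫ x in Ioo 0 T, ∫ h, (u (x + h) - u x) ^ 2 / |h| ^ (1 + 2 * s) := by
      congr 1
      ext x
      rw [← integral_add_left_eq_self _ x]
      congr 1
      ext h
      rw [sub_sq_comm, show x - (x + h) = -h by ring, abs_neg]
    unfold Fs
    rw [h3, integral_integral_swap hint]
    simp only [hslice]
    rw [h2]
    field_simp

/-- The function equal to `0` before `0`, to `δ` after `δ`, and to the identity in between. -/
def ramp (δ x : ℝ) : ℝ := max 0 (min x δ)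

lemma continuous_ramp (δ : ℝ) : Continuous (ramp δ) := by
  unfold ramp; fun_prop

lemma ramp_of_nonpos {δ x : ℝ} (hx : x ≤ 0) : ramp δ x = 0 :=
  max_eq_left ((min_le_left _ _).trans hx)

lemma ramp_of_mem {δ x : ℝ} (h0 : 0 ≤ x) (h1 : x ≤ δ) : ramp δ x = x := by
  rw [ramp, min_eq_left h1, max_eq_right h0]

lemma ramp_of_le {δ x : ℝ} (h0 : 0 ≤ δ) (h1 : δ ≤ x) : ramp δ x = δ := by
  rw [ramp, min_eq_right h1, max_eq_right h0]

lemma ramp_mono (δ : ℝ) : Monotone (ramp δ) := fun _ _ h =>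
  max_le_max le_rfl (min_le_min h le_rfl)

/-- The integral of the squared increment of `ramp δ` with step `h`. -/
def rampIncr (δ h : ℝ) : ℝ := ∫ x in (-h)..δ, (ramp δ (x + h) - ramp δ x) ^ 2

lemma intervalIntegrable_ramp (δ h a b : ℝ) :
    IntervalIntegrable (fun x => (ramp δ (x + h) - ramp δ x) ^ 2) volume a b := by
  have := continuous_ramp δ
  exact Continuous.intervalIntegrable (by fun_prop) _ _

lemma rampIncr_of_le {δ h : ℝ} (h0 : 0 ≤ h) (hδ : h ≤ δ) :
    rampIncr δ h = h ^ 2 * δ - h ^ 3 / 3 := by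
  have hδ0 := h0.trans hδ
  have hi := intervalIntegrable_ramp δ h
  rw [rampIncr, ← intervalIntegral.integral_add_adjacent_intervals (hi (-h) 0) (hi 0 δ),
    ← intervalIntegral.integral_add_adjacent_intervals (hi 0 (δ - h)) (hi (δ - h) δ)]
  have e1 : ∫ x in (-h)..0, (ramp δ (x + h) - ramp δ x) ^ 2 = ∫ x in (-h)..0, (x + h) ^ 2 := by
    refine intervalIntegral.integral_congr fun x hx => ?_
    rw [uIcc_of_le (by linarith)] at hx
    simp only [ramp_of_nonpos hx.2, ramp_of_mem (show 0 ≤ x + h by linarith [hx.1])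
      (show x + h ≤ δ by linarith [hx.2]), sub_zero]
  have e2 : ∫ x in (0 : ℝ)..(δ - h), (ramp δ (x + h) - ramp δ x) ^ 2 =
      ∫ x in (0 : ℝ)..(δ - h), h ^ 2 := by
    refine intervalIntegral.integral_congr fun x hx => ?_
    rw [uIcc_of_le (by linarith)] at hx
    simp only [ramp_of_mem hx.1 (show x ≤ δ by linarith [hx.2]),
      ramp_of_mem (show 0 ≤ x + h by linarith [hx.1]) (show x + h ≤ δ by linarith [hx.2])]
    ring
  have e3 : ∫ x in (δ - h)..δ, (ramp δ (x + h) - ramp δ x) ^ 2 =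
      ∫ x in (δ - h)..δ, (δ - x) ^ 2 := by
    refine intervalIntegral.integral_congr fun x hx => ?_
    rw [uIcc_of_le (by linarith)] at hx
    simp only [ramp_of_mem (show 0 ≤ x by linarith [hx.1]) hx.2,
      ramp_of_le hδ0 (show δ ≤ x + h by linarith [hx.1])]
  rw [e1, e2, e3, intervalIntegral.integral_comp_add_right (fun x => x ^ 2),
    intervalIntegral.integral_comp_sub_left (fun x => x ^ 2)]
  simp only [integral_pow, intervalIntegral.integral_const, smul_eq_mul]
  ring

lemma rampIncr_of_ge {δ h : ℝ} (h0 : 0 ≤ δ) (hδ : δ ≤ h) :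
    rampIncr δ h = δ ^ 2 * h - δ ^ 3 / 3 := by
  have hi := intervalIntegrable_ramp δ h
  rw [rampIncr, ← intervalIntegral.integral_add_adjacent_intervals (hi (-h) 0) (hi 0 δ),
    ← intervalIntegral.integral_add_adjacent_intervals (hi (-h) (δ - h)) (hi (δ - h) 0)]
  have e1 : ∫ x in (-h)..(δ - h), (ramp δ (x + h) - ramp δ x) ^ 2 =
      ∫ x in (-h)..(δ - h), (x + h) ^ 2 := by
    refine intervalIntegral.integral_congr fun x hx => ?_
    rw [uIcc_of_le (by linarith)] at hx
    simp only [ramp_of_nonpos (show x ≤ 0 by linarith [hx.2]),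
      ramp_of_mem (show 0 ≤ x + h by linarith [hx.1])
      (show x + h ≤ δ by linarith [hx.2]), sub_zero]
  have e2 : ∫ x in (δ - h)..0, (ramp δ (x + h) - ramp δ x) ^ 2 =
      ∫ x in (δ - h)..0, δ ^ 2 := by
    refine intervalIntegral.integral_congr fun x hx => ?_
    rw [uIcc_of_le (by linarith)] at hx
    simp only [ramp_of_nonpos hx.2, ramp_of_le h0 (show δ ≤ x + h by linarith [hx.1]), sub_zero]
  have e3 : ∫ x in (0 : ℝ)..δ, (ramp δ (x + h) - ramp δ x) ^ 2 =
      ∫ x in (0 : ℝ)..δ, (δ - x) ^ 2 := by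
    refine intervalIntegral.integral_congr fun x hx => ?_
    rw [uIcc_of_le (by linarith)] at hx
    simp only [ramp_of_mem hx.1 hx.2, ramp_of_le h0 (show δ ≤ x + h by linarith [hx.1])]
  rw [e1, e2, e3, intervalIntegral.integral_comp_add_right (fun x => x ^ 2),
    intervalIntegral.integral_comp_sub_left (fun x => x ^ 2)]
  simp only [integral_pow, intervalIntegral.integral_const, smul_eq_mul]
  ring

lemma rpow_mul_natPow_div {h s : ℝ} (hh : 0 < h) (k : ℕ) :
    h ^ k / h ^ (1 + 2 * s) = h ^ ((k : ℝ) - 1 - 2 * s) := by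
  rw [← Real.rpow_natCast, ← Real.rpow_sub hh]
  ring_nf

lemma integral_rampIncr {s δ : ℝ} (hs : 1 / 2 < s) (hs1 : s < 1) (h0 : 0 < δ) (hδ : δ ≤ 1) :
    IntervalIntegrable (fun h => rampIncr δ h / h ^ (1 + 2 * s)) volume 0 1 ∧
    ∫ h in (0 : ℝ)..1, rampIncr δ h / h ^ (1 + 2 * s) =
      δ ^ 2 * (δ ^ (1 - 2 * s) / (2 * s * (1 - s) * (2 * s - 1) * (3 - 2 * s))
        - 1 / (2 * s - 1) + δ / (6 * s)) := by
  have c1 : EqOn (fun h => δ * h ^ (1 - 2 * s) - h ^ (2 - 2 * s) / 3)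
      (fun h => rampIncr δ h / h ^ (1 + 2 * s)) (uIoc 0 δ) := by
    intro h hh
    rw [uIoc_of_le h0.le] at hh
    simp only [rampIncr_of_le hh.1.le hh.2]
    have h2 := rpow_mul_natPow_div (s := s) hh.1 2
    have h3 := rpow_mul_natPow_div (s := s) hh.1 3
    rw [show ((2 : ℕ) : ℝ) - 1 - 2 * s = 1 - 2 * s by push_cast; ring] at h2
    rw [show ((3 : ℕ) : ℝ) - 1 - 2 * s = 2 - 2 * s by push_cast; ring] at h3
    rw [← h2, ← h3]
    ring
  have c2 : EqOn (fun h => δ ^ 2 * h ^ (-2 * s) - δ ^ 3 / 3 * h ^ (-1 - 2 * s))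
      (fun h => rampIncr δ h / h ^ (1 + 2 * s)) (uIoc δ 1) := by
    intro h hh
    rw [uIoc_of_le hδ] at hh
    simp only [rampIncr_of_ge h0.le hh.1.le]
    have h2 := rpow_mul_natPow_div (s := s) (h0.trans hh.1) 1
    have h3 := rpow_mul_natPow_div (s := s) (h0.trans hh.1) 0
    rw [show ((1 : ℕ) : ℝ) - 1 - 2 * s = -2 * s by push_cast; ring] at h2
    rw [show ((0 : ℕ) : ℝ) - 1 - 2 * s = -1 - 2 * s by push_cast; ring] at h3
    rw [← h2, ← h3]
    ring
  have n0 : (0 : ℝ) ∉ uIcc δ 1 := by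
    rw [uIcc_of_le hδ]; exact fun h => absurd h.1 (not_le.2 h0)
  have i1 : IntervalIntegrable (fun h : ℝ => h ^ (1 - 2 * s)) volume 0 δ :=
    intervalIntegral.intervalIntegrable_rpow' (by linarith)
  have i2 : IntervalIntegrable (fun h : ℝ => h ^ (2 - 2 * s)) volume 0 δ :=
    intervalIntegral.intervalIntegrable_rpow' (by linarith)
  have i3 : IntervalIntegrable (fun h : ℝ => h ^ (-2 * s)) volume δ 1 :=
    intervalIntegral.intervalIntegrable_rpow (Or.inr n0)
  have i4 : IntervalIntegrable (fun h : ℝ => h ^ (-1 - 2 * s)) volume δ 1 :=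
    intervalIntegral.intervalIntegrable_rpow (Or.inr n0)
  have j1 := (i1.const_mul δ).sub (i2.div_const 3)
  have j2 := (i3.const_mul (δ ^ 2)).sub (i4.const_mul (δ ^ 3 / 3))
  have k1 := j1.congr c1
  have k2 := j2.congr c2
  refine ⟨k1.trans k2, ?_⟩
  rw [← intervalIntegral.integral_add_adjacent_intervals k1 k2,
    ← intervalIntegral.integral_congr_ae (Eventually.of_forall fun h hh => c1 hh),
    ← intervalIntegral.integral_congr_ae (Eventually.of_forall fun h hh => c2 hh),
    intervalIntegral.integral_sub (i1.const_mul δ) (i2.div_const 3),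
    intervalIntegral.integral_sub (i3.const_mul (δ ^ 2)) (i4.const_mul (δ ^ 3 / 3))]
  simp only [intervalIntegral.integral_const_mul, intervalIntegral.integral_div]
  rw [integral_rpow (Or.inl (by linarith)), integral_rpow (Or.inl (by linarith)),
    integral_rpow (Or.inr ⟨by linarith, n0⟩), integral_rpow (Or.inr ⟨by linarith, n0⟩)]
  have p (k : ℕ) : δ ^ ((k : ℝ) + (1 - 2 * s)) = δ ^ k * δ ^ (1 - 2 * s) := by
    rw [Real.rpow_add h0, Real.rpow_natCast]
  have e1 : δ ^ (1 - 2 * s + 1) = δ * δ ^ (1 - 2 * s) := by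
    have := p 1; rw [pow_one] at this; rw [← this]; congr 1; push_cast; ring
  have e2 : δ ^ (2 - 2 * s + 1) = δ ^ 2 * δ ^ (1 - 2 * s) := by
    rw [← p 2]; congr 1; push_cast; ring
  have e3 : δ ^ (-2 * s + 1) = δ ^ (1 - 2 * s) := by congr 1; ring
  have e4 : δ ^ (-1 - 2 * s + 1) = δ ^ (1 - 2 * s) / δ := by
    rw [← Real.rpow_sub_one h0.ne']; congr 1; ring
  rw [e1, e2, e3, e4, Real.zero_rpow (by linarith), Real.zero_rpow (by linarith), Real.one_rpow,
    Real.one_rpow]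
  have a1 : 1 - 2 * s + 1 ≠ 0 := by linarith
  have a2 : 2 - 2 * s + 1 ≠ 0 := by linarith
  have a3 : -2 * s + 1 ≠ 0 := by linarith
  have a4 : -1 - 2 * s + 1 ≠ 0 := by linarith
  have a5 : s ≠ 0 := by linarith
  have a6 : 1 - s ≠ 0 := by linarith
  have a7 : 2 * s - 1 ≠ 0 := by linarith
  have a8 : 3 - 2 * s ≠ 0 := by linarith
  rw [show 1 - 2 * s + 1 = 2 * (1 - s) by ring, show 2 - 2 * s + 1 = 3 - 2 * s by ring,
    show -2 * s + 1 = -(2 * s - 1) by ring, show -1 - 2 * s + 1 = -(2 * s) by ring]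
  field_simp
  ring

lemma PiecewiseAffine.exists_countable {u : ℝ → ℝ} (hu : PiecewiseAffine u) :
    ∃ N : Set ℝ, N.Countable ∧
      ∀ x ∉ N, ∃ ε > 0, ∃ m q : ℝ, ∀ y : ℝ, |y - x| < ε → u y = m * y + q := by
  obtain ⟨S, -, hS, hu⟩ := hu
  refine ⟨S, ?_, hu⟩
  refine (HereditarilyLindelofSpace.isLindelof S).countable_of_isDiscrete ?_
  refine IsDiscrete.of_nhdsWithin fun x hx => ?_
  obtain ⟨ε, hε, h⟩ := hS x hx
  rw [le_pure_iff]
  exact mem_of_superset (inter_mem_nhdsWithin S (Ioo_mem_nhds (by linarith) (by linarith))) h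

lemma Admissible.exists_countable {T Λ δ : ℝ} {u : ℝ → ℝ} (h : Admissible T Λ δ u) :
    ∃ N : Set ℝ, N.Countable ∧ ∀ x ∉ N, HasDerivAt u 1 x ∨ HasDerivAt u (-Λ) x := by
  obtain ⟨N, hN, hu⟩ := h.pwAffine.exists_countable
  refine ⟨N, hN, fun x hx => ?_⟩
  obtain ⟨ε, hε, m, q, hm⟩ := hu x hx
  have hderiv : ∀ y ∈ Ioo (x - ε) (x + ε), HasDerivAt u m y := by
    intro y hy
    have h1 : HasDerivAt (fun z => m * z + q) m y := by
      simpa using ((hasDerivAt_id y).const_mul m).add_const q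
    refine h1.congr_of_eventuallyEq ?_
    filter_upwards [Ioo_mem_nhds hy.1 hy.2] with z hz
    exact hm z (abs_sub_lt_iff.2 ⟨by linarith [hz.2], by linarith [hz.1]⟩)
  obtain ⟨y, hy, hy'⟩ : ∃ y ∈ Ioo (x - ε) (x + ε), HasDerivAt u 1 y ∨ HasDerivAt u (-Λ) y := by
    by_contra! hcon
    have h0 : volume (Ioo (x - ε) (x + ε)) = 0 := by
      refine measure_mono_null (fun y hy => ?_) h.slopes
      simpa [not_or] using hcon y hy
    rw [Real.volume_Ioo, ENNReal.ofReal_eq_zero] at h0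
    linarith
  have hx' := hderiv x ⟨by linarith, by linarith⟩
  rcases hy' with hy' | hy'
  · exact Or.inl (((hderiv y hy).unique hy') ▸ hx')
  · exact Or.inr (((hderiv y hy).unique hy') ▸ hx')

lemma Admissible.abs_sub_le {T Λ δ : ℝ} {u : ℝ → ℝ} (h : Admissible T Λ δ u) (x y : ℝ) :
    |u x - u y| ≤ max 1 |Λ| * |x - y| := by
  obtain ⟨N, hN, hu⟩ := h.exists_countable
  have hb : ∀ z ∉ N, HasDerivAt u (deriv u z) z ∧ ‖deriv u z‖ ≤ max 1 |Λ| := by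
    intro z hz
    rcases hu z hz with hz | hz <;> rw [hz.deriv] <;> refine ⟨hz, ?_⟩ <;> simp
  have hae : ∀ᵐ z : ℝ, ‖deriv u z‖ ≤ max 1 |Λ| := by
    filter_upwards [hN.ae_notMem volume] with z hz using (hb z hz).2
  have hi : IntervalIntegrable (deriv u) volume y x := by
    rw [intervalIntegrable_iff]
    exact Measure.integrableOn_of_bounded (by simp) (measurable_deriv u).aestronglyMeasurable
      (ae_restrict_of_ae hae)
  rw [← integral_eq_of_hasDerivAt_off_countable u (deriv u) hN h.cont.continuousOn
    (fun z hz => (hb z hz.2).1) hi]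
  exact intervalIntegral.norm_integral_le_of_norm_le_const_ae
    (hae.mono fun z hz _ => hz)

lemma hasDerivAt_ramp_sub {δ a x : ℝ} (hδ : 0 < δ) (h1 : x ≠ a) (h2 : x ≠ a + δ) :
    HasDerivAt (fun y => ramp δ (y - a)) (if a < x ∧ x < a + δ then 1 else 0) x := by
  rcases h1.lt_or_gt with h1 | h1
  · rw [if_neg (fun h => absurd h.1 h1.not_gt)]
    refine (hasDerivAt_const x (0 : ℝ)).congr_of_eventuallyEq ?_
    filter_upwards [Iio_mem_nhds h1] with y hy
    exact ramp_of_nonpos (by linarith [mem_Iio.1 hy])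
  rcases h2.lt_or_gt with h2 | h2
  · rw [if_pos ⟨h1, h2⟩]
    refine ((hasDerivAt_id x).sub_const a).congr_of_eventuallyEq ?_
    filter_upwards [Ioo_mem_nhds h1 h2] with y hy
    exact ramp_of_mem (by linarith [hy.1]) (by linarith [hy.2])
  · rw [if_neg (fun h => absurd h.2 h2.not_gt)]
    refine (hasDerivAt_const x δ).congr_of_eventuallyEq ?_
    filter_upwards [Ioi_mem_nhds h2] with y hy
    exact ramp_of_le hδ.le (by linarith [mem_Ioi.1 hy])

lemma exists_isMax_of_periodic {u : ℝ → ℝ} {T : ℝ} (hT : 0 < T) (hc : Continuous u)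
    (hper : Function.Periodic u T) : ∃ c, ∀ x, u x ≤ u c := by
  obtain ⟨c, -, hmax⟩ := isCompact_Icc.exists_isMaxOn (nonempty_Icc.2 hT.le) hc.continuousOn
  refine ⟨c, fun x => ?_⟩
  obtain ⟨y, hy, hxy⟩ := hper.exists_mem_Ico₀ hT x
  rw [hxy]
  exact hmax (Ico_subset_Icc_self hy)

lemma add_le_or_add_le_of_subsingleton_inter {δ a b : ℝ} (hδ : 0 < δ)
    (h : (Icc a (a + δ) ∩ Icc b (b + δ)).Subsingleton) : a + δ ≤ b ∨ b + δ ≤ a := by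
  by_contra! hcon
  have h1 : max a b ∈ Icc a (a + δ) ∩ Icc b (b + δ) :=
    ⟨⟨le_max_left _ _, max_le (by linarith) (by linarith)⟩,
      ⟨le_max_right _ _, max_le (by linarith) (by linarith)⟩⟩
  have h2 : min a b + δ ∈ Icc a (a + δ) ∩ Icc b (b + δ) := by
    rcases le_total a b with hab | hab
    · rw [min_eq_left hab]; exact ⟨⟨by linarith, by linarith⟩, by linarith, by linarith⟩
    · rw [min_eq_right hab]; exact ⟨⟨by linarith, by linarith⟩, by linarith, by linarith⟩
  have h3 := h h1 h2
  rcases le_total a b with hab | hab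
  · rw [min_eq_left hab, max_eq_right hab] at h3; linarith
  · rw [min_eq_right hab, max_eq_left hab] at h3; linarith

lemma finite_of_separated {a : ℕ → ℝ} {δ : ℝ} (hδ : 0 < δ)
    (ha : ∀ i j, i ≠ j → a i + δ ≤ a j ∨ a j + δ ≤ a i) (c d : ℝ) :
    {k | a k ∈ Ico c d}.Finite := by
  refine Finite.of_finite_image (f := fun k => ⌊a k / δ⌋) ?_ ?_
  · refine (finite_Icc ⌊c / δ⌋ ⌊d / δ⌋).subset ?_
    rintro _ ⟨k, hk, rfl⟩
    exact ⟨Int.floor_le_floor (by gcongr; exact hk.1), Int.floor_le_floor (by gcongr; exact hk.2.le)⟩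
  · intro i _ j _ hij
    by_contra hne
    have h1 := Int.abs_sub_lt_one_of_floor_eq_floor hij
    rw [← sub_div, abs_div, abs_of_pos hδ, div_lt_one hδ, abs_lt] at h1
    rcases ha i j hne with h | h <;> linarith

lemma Admissible.exists_eq_sum_ramp {T Λ δ : ℝ} {u : ℝ → ℝ} (hT : 0 < T) (hΛ : 0 < Λ) (hδ : 0 < δ)
    (h : Admissible T Λ δ u) :
    ∃ (c : ℝ) (S : Finset ℕ) (a : ℕ → ℝ), (∀ k ∈ S, c ≤ a k ∧ a k + δ ≤ c + T) ∧
      ∀ x ∈ Icc c (c + T), u x = u c + (x - c) - (Λ + 1) * ∑ k ∈ S, ramp δ (x - a k) := by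
  obtain ⟨c, hc⟩ := exists_isMax_of_periodic hT h.cont h.per
  obtain ⟨N, hN, hu⟩ := h.exists_countable
  obtain ⟨a, ha1, ha2, ha3⟩ := h.negRegion
  have hsep : ∀ i j, i ≠ j → a i + δ ≤ a j ∨ a j + δ ≤ a i := fun i j hij =>
    add_le_or_add_le_of_subsingleton_inter hδ (ha3 hij)
  have hmax : ∀ d, (∀ x, u x ≤ u d) → ∀ k, d ∉ Ioo (a k) (a k + δ) := by
    intro d hd k hk
    have := IsLocalMax.hasDerivAt_eq_zero (Eventually.of_forall hd : IsLocalMax u d) (ha1 k hk)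
    linarith
  have hc1 := hmax c hc
  have hc2 := hmax (c + T) (fun x => by rw [h.per]; exact hc x)
  set S := (finite_of_separated hδ hsep c (c + T)).toFinset with hSdef
  have hS : ∀ k, k ∈ S ↔ a k ∈ Ico c (c + T) := fun k => by simp [hSdef]
  have hSle : ∀ k ∈ S, c ≤ a k ∧ a k + δ ≤ c + T := by
    intro k hk
    have hk := (hS k).1 hk
    exact ⟨hk.1, not_lt.1 fun hlt => hc2 k ⟨hk.2, hlt⟩⟩
  refine ⟨c, S, a, hSle, fun x hx => ?_⟩
  have hcr := continuous_ramp δ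
  have hcu := h.cont
  have key := integral_eq_of_hasDerivAt_off_countable_of_le
    (fun y => u y - y + (Λ + 1) * ∑ k ∈ S, ramp δ (y - a k)) (fun _ => 0) hx.1
    (s := N ∪ range a ∪ range fun k => a k + δ)
    ((hN.union (countable_range _)).union (countable_range _))
    (Continuous.continuousOn (by fun_prop)) (fun y hy => ?_) (by simp)
  · have h0 : ∑ k ∈ S, ramp δ (c - a k) = 0 :=
      Finset.sum_eq_zero fun k hk => ramp_of_nonpos (by linarith [(hSle k hk).1])
    simp only [intervalIntegral.integral_zero, h0] at key
    linarith
  · obtain ⟨⟨hy1, hy2⟩, hyN⟩ := hy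
    simp only [mem_union, mem_range, not_or, not_exists] at hyN
    obtain ⟨⟨hyN, hya⟩, hyb⟩ := hyN
    have hsum : HasDerivAt (fun y => ∑ k ∈ S, ramp δ (y - a k))
        (∑ k ∈ S, if a k < y ∧ y < a k + δ then 1 else 0) y :=
      HasDerivAt.fun_sum fun k _ => hasDerivAt_ramp_sub hδ (Ne.symm (hya k)) (Ne.symm (hyb k))
    rcases hu y hyN with hy | hy
    · have h0 : (∑ k ∈ S, if a k < y ∧ y < a k + δ then (1 : ℝ) else 0) = 0 := by
        refine Finset.sum_eq_zero fun k _ => if_neg fun hk => ?_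
        have := hy.unique (ha1 k hk)
        linarith
      rw [h0] at hsum
      simpa using (hy.fun_sub (hasDerivAt_id' y)).fun_add (hsum.const_mul (Λ + 1))
    · obtain ⟨k₀, hk₀⟩ := mem_iUnion.1 (ha2 hy)
      have hl := lt_of_le_of_ne hk₀.1 (hya k₀)
      have hr := lt_of_le_of_ne hk₀.2 (Ne.symm (hyb k₀))
      have hk₀S : k₀ ∈ S := (hS k₀).2
        ⟨not_lt.1 fun hlt => hc1 k₀ ⟨hlt, by linarith⟩, by linarith [hx.2]⟩
      have h1 : (∑ k ∈ S, if a k < y ∧ y < a k + δ then (1 : ℝ) else 0) = 1 := by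
        rw [Finset.sum_eq_single_of_mem k₀ hk₀S, if_pos ⟨hl, hr⟩]
        intro k _ hk
        refine if_neg fun hky => ?_
        rcases hsep k k₀ hk with h' | h' <;> linarith [hky.1, hky.2]
      rw [h1] at hsum
      convert (hy.fun_sub (hasDerivAt_id' y)).fun_add (hsum.const_mul (Λ + 1)) using 1
      ring

lemma Admissible.exists_sub_eq {T Λ δ : ℝ} {u : ℝ → ℝ} (hT : 0 < T) (hΛ : 0 < Λ) (hδ : 0 < δ)
    (h : Admissible T Λ δ u) :
    ∃ (c : ℝ) (S : Finset ℕ) (a : ℕ → ℝ), (∀ k ∈ S, c ≤ a k ∧ a k + δ ≤ c + T) ∧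
      T = (Λ + 1) * (S.card * δ) ∧ ∀ x ∈ Icc c (c + T), ∀ t ∈ Icc 0 T,
        u (x + t) - u x = t - (Λ + 1) * ∑ k ∈ S, ((ramp δ (x + t - a k) - ramp δ (x - a k)) +
          (ramp δ (x - T + t - a k) - ramp δ (x - T - a k))) := by
  obtain ⟨c, S, a, hS, hu⟩ := h.exists_eq_sum_ramp hT hΛ hδ
  have hfull : ∀ x ≥ c + T, ∑ k ∈ S, ramp δ (x - a k) = S.card * δ := by
    intro x hx
    rw [Finset.sum_congr rfl fun k hk => ramp_of_le hδ.le (show δ ≤ x - a k by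
      linarith [(hS k hk).2])]
    simp
  have hzero : ∀ x ≤ c, ∑ k ∈ S, ramp δ (x - a k) = 0 := fun x hx =>
    Finset.sum_eq_zero fun k hk => ramp_of_nonpos (by linarith [(hS k hk).1])
  have hcard : T = (Λ + 1) * (S.card * δ) := by
    have h1 := hu (c + T) ⟨by linarith, le_rfl⟩
    rw [h.per, hfull _ le_rfl] at h1
    linarith
  refine ⟨c, S, a, hS, hcard, fun x hx t ht => ?_⟩
  simp only [Finset.sum_add_distrib, Finset.sum_sub_distrib]
  rw [hzero (x - T) (by linarith [hx.2]), hu x hx]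
  rcases le_total (x + t) (c + T) with hle | hle
  · rw [hzero (x - T + t) (by linarith), hu (x + t) ⟨by linarith [hx.1, ht.1], hle⟩]
    ring
  · rw [hfull (x + t) hle, show x + t = x - T + t + T by ring, h.per,
      hu (x - T + t) ⟨by linarith, by linarith [hx.2, ht.2]⟩]
    linarith

/-- The part of order `δ ^ (1 - 2 * s)` of the energy density of a periodic sawtooth, up to the
factor given by the height of its jumps. -/
def coreEnergy (s δ : ℝ) : ℝ :=
  δ ^ (1 - 2 * s) / (2 * s * (1 - s) * (2 * s - 1) * (3 - 2 * s)) - 1 / (2 * s - 1) + δ / (6 * s)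

lemma integral_rampIncr_add_sq {s δ : ℝ} (hs : 1 / 2 < s) (hs1 : s < 1) (h0 : 0 < δ) (hδ : δ ≤ 1)
    (A B : ℝ) :
    IntegrableOn (fun h => (A * rampIncr δ h + B * h ^ 2) / h ^ (1 + 2 * s)) (Ioc 0 1) ∧
    ∫ h in Ioc (0 : ℝ) 1, (A * rampIncr δ h + B * h ^ 2) / h ^ (1 + 2 * s) =
      A * (δ ^ 2 * coreEnergy s δ) + B / (2 - 2 * s) := by
  obtain ⟨h1, h2⟩ := integral_rampIncr hs hs1 h0 hδ
  have h3 : IntervalIntegrable (fun h : ℝ => h ^ (1 - 2 * s)) volume 0 1 :=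
    intervalIntegral.intervalIntegrable_rpow' (by linarith)
  have heq : EqOn (fun h => A * (rampIncr δ h / h ^ (1 + 2 * s)) + B * h ^ (1 - 2 * s))
      (fun h => (A * rampIncr δ h + B * h ^ 2) / h ^ (1 + 2 * s)) (Ioc 0 1) := by
    intro h hh
    have h4 := rpow_mul_natPow_div (s := s) hh.1 2
    rw [show ((2 : ℕ) : ℝ) - 1 - 2 * s = 1 - 2 * s by push_cast; ring] at h4
    simp only
    rw [← h4]
    ring
  have h5 := (h1.const_mul A).add (h3.const_mul B)
  rw [intervalIntegrable_iff_integrableOn_Ioc_of_le zero_le_one] at h5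
  refine ⟨h5.congr_fun heq measurableSet_Ioc, ?_⟩
  rw [← setIntegral_congr_fun measurableSet_Ioc heq,
    ← intervalIntegral.integral_of_le zero_le_one,
    intervalIntegral.integral_add (h1.const_mul A) (h3.const_mul B),
    intervalIntegral.integral_const_mul, intervalIntegral.integral_const_mul, h2,
    integral_rpow (Or.inl (by linarith)), Real.one_rpow, Real.zero_rpow (by linarith), coreEnergy]
  ring

lemma sum_sq_le_sq_sum_of_nonneg {ι : Type*} (S : Finset ι) {f : ι → ℝ} (hf : ∀ i, 0 ≤ f i) :
    ∑ i ∈ S, f i ^ 2 ≤ (∑ i ∈ S, f i) ^ 2 := by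
  classical
  induction S using Finset.induction_on with
  | empty => simp
  | insert i S hi ih =>
    rw [Finset.sum_insert hi, Finset.sum_insert hi]
    nlinarith [mul_nonneg (hf i) (Finset.sum_nonneg fun j (_ : j ∈ S) => hf j)]

lemma sub_sq_ge {ε : ℝ} (hε : 0 < ε) (h p : ℝ) :
    (1 - ε) * p ^ 2 - (1 / ε - 1) * h ^ 2 ≤ (h - p) ^ 2 := by
  have : (h - p) ^ 2 - ((1 - ε) * p ^ 2 - (1 / ε - 1) * h ^ 2) = (ε * p - h) ^ 2 / ε := by
    field_simp; ring
  have h2 : 0 ≤ (ε * p - h) ^ 2 / ε := by positivity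
  linarith

lemma sub_sq_le {ε : ℝ} (hε : 0 < ε) (h p : ℝ) :
    (h - p) ^ 2 ≤ (1 + ε) * p ^ 2 + (1 + 1 / ε) * h ^ 2 := by
  have : ((1 + ε) * p ^ 2 + (1 + 1 / ε) * h ^ 2) - (h - p) ^ 2 = (ε * p + h) ^ 2 / ε := by
    field_simp; ring
  have h2 : 0 ≤ (ε * p + h) ^ 2 / ε := by positivity
  linarith

lemma Admissible.le_sqIncr {T Λ δ ε h : ℝ} {u : ℝ → ℝ} (hT : 0 < T) (hΛ : 0 < Λ)
    (hδ : 0 < δ) (hu : Admissible T Λ δ u) (hε : 0 < ε) (hε1 : ε ≤ 1) (h0 : 0 ≤ h) (hh : h ≤ T) :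
    T * ((1 - ε) * ((Λ + 1) / δ) * rampIncr δ h - (1 / ε - 1) * h ^ 2) ≤ sqIncr u T h := by
  obtain ⟨c, S, a, hS, hcard, heq⟩ := hu.exists_sub_eq hT hΛ hδ
  have hF : Function.Periodic (fun x => (u (x + h) - u x) ^ 2) T := by
    intro x
    simp only
    rw [show x + T + h = x + h + T by ring, hu.per, hu.per]
  have h1 := hF.intervalIntegral_add_eq 0 c
  rw [zero_add] at h1
  have hcr := continuous_ramp δ
  have hcu := hu.cont
  have hint (d x y : ℝ) :
      IntervalIntegrable (fun x => (ramp δ (x - d + h) - ramp δ (x - d)) ^ 2) volume x y :=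
    Continuous.intervalIntegrable (by fun_prop) _ _
  have hk : ∀ k ∈ S, rampIncr δ h ≤
      ∫ x in c..(c + T), ((ramp δ (x + h - a k) - ramp δ (x - a k)) ^ 2 +
          (ramp δ (x - T + h - a k) - ramp δ (x - T - a k)) ^ 2) := by
    intro k hk
    have e1 (x : ℝ) : x + h - a k = x - a k + h := by ring
    have e3 (x : ℝ) : x - T - a k = x - (T + a k) := by ring
    simp only [e1, e3]
    rw [intervalIntegral.integral_add (hint _ _ _) (hint _ _ _),
      intervalIntegral.integral_comp_sub_right (fun x => (ramp δ (x + h) - ramp δ x) ^ 2),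
      intervalIntegral.integral_comp_sub_right (fun x => (ramp δ (x + h) - ramp δ x) ^ 2), add_comm,
      show c + T - (T + a k) = c - a k by ring,
      intervalIntegral.integral_add_adjacent_intervals (intervalIntegrable_ramp _ _ _ _)
        (intervalIntegrable_ramp _ _ _ _)]
    obtain ⟨hk1, hk2⟩ := hS k hk
    exact intervalIntegral.integral_mono_interval (by linarith) (by linarith) (by linarith)
      (Eventually.of_forall fun x => sq_nonneg _) (intervalIntegrable_ramp _ _ _ _)
  rw [sqIncr, h1]
  calc T * ((1 - ε) * ((Λ + 1) / δ) * rampIncr δ h - (1 / ε - 1) * h ^ 2)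
      = (1 - ε) * (Λ + 1) ^ 2 * ∑ k ∈ S, rampIncr δ h - T * ((1 / ε - 1) * h ^ 2) := by
        rw [Finset.sum_const, nsmul_eq_mul]
        nth_rewrite 1 [mul_sub, hcard]
        field_simp
    _ ≤ (1 - ε) * (Λ + 1) ^ 2 * ∑ k ∈ S,
          (∫ x in c..(c + T), ((ramp δ (x + h - a k) - ramp δ (x - a k)) ^ 2 +
          (ramp δ (x - T + h - a k) - ramp δ (x - T - a k)) ^ 2)) - T * ((1 / ε - 1) * h ^ 2) := by
        have := sub_nonneg.2 hε1
        gcongr with k hk'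
        exact hk k hk'
    _ = ∫ x in c..(c + T), ((1 - ε) * (Λ + 1) ^ 2 * ∑ k ∈ S,
          ((ramp δ (x + h - a k) - ramp δ (x - a k)) ^ 2 +
          (ramp δ (x - T + h - a k) - ramp δ (x - T - a k)) ^ 2) - (1 / ε - 1) * h ^ 2) := by
        rw [intervalIntegral.integral_sub (Continuous.intervalIntegrable (by fun_prop) _ _)
          (by simp), intervalIntegral.integral_const_mul, intervalIntegral.integral_finsetSum]
        · simp only [intervalIntegral.integral_const, smul_eq_mul]
          ring
        · intro k _
          exact Continuous.intervalIntegrable (by fun_prop) _ _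
    _ ≤ ∫ x in c..(c + T), (u (x + h) - u x) ^ 2 := by
        refine intervalIntegral.integral_mono_on (by linarith)
          (Continuous.intervalIntegrable (by fun_prop) _ _)
          (Continuous.intervalIntegrable (by fun_prop) _ _) fun x hx => ?_
        rw [heq x hx h ⟨h0, hh⟩]
        refine le_trans ?_ (sub_sq_ge hε _ _)
        rw [mul_pow, ← mul_assoc]
        have := sub_nonneg.2 hε1
        have hb1 (k : ℕ) : 0 ≤ ramp δ (x + h - a k) - ramp δ (x - a k) :=
          sub_nonneg.2 (ramp_mono δ (by linarith))
        have hb2 (k : ℕ) : 0 ≤ ramp δ (x - T + h - a k) - ramp δ (x - T - a k) :=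
          sub_nonneg.2 (ramp_mono δ (by linarith))
        gcongr
        refine le_trans (Finset.sum_le_sum fun k _ => ?_)
          (sum_sq_le_sq_sum_of_nonneg S fun k => add_nonneg (hb1 k) (hb2 k))
        nlinarith [mul_nonneg (hb1 k) (hb2 k)]

lemma Admissible.Fs_eq {s T Λ δ : ℝ} {u : ℝ → ℝ} (hs : 0 < s) (hs1 : s < 1) (hT : 0 < T)
    (hu : Admissible T Λ δ u) :
    IntegrableOn (fun h => sqIncr u T h / h ^ (1 + 2 * s)) (Ioi 0) ∧
      Fs s T u = 1 / T * ∫ h in Ioi (0 : ℝ), sqIncr u T h / h ^ (1 + 2 * s) := by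
  obtain ⟨C, hC⟩ := Metric.isBounded_range_iff.1 (hu.per.isBounded_of_continuous hT.ne' hu.cont)
  refine Fs_eq_integral_sqIncr hs hs1 hT hu.cont hu.per hu.abs_sub_le (M := C ^ 2) fun x y => ?_
  rw [← sq_abs]
  gcongr
  exact hC x y

lemma Admissible.le_Fs {s T Λ δ ε : ℝ} {u : ℝ → ℝ} (hs : 1 / 2 < s) (hs1 : s < 1) (hT : 1 ≤ T)
    (hΛ : 0 < Λ) (hδ : 0 < δ) (hδ1 : δ ≤ 1) (hu : Admissible T Λ δ u) (hε : 0 < ε) (hε1 : ε ≤ 1) :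
    (1 - ε) * ((Λ + 1) * δ) * coreEnergy s δ - (1 / ε - 1) / (2 - 2 * s) ≤ Fs s T u := by
  have hT0 : 0 < T := by linarith
  obtain ⟨hi, hF⟩ := hu.Fs_eq (by linarith) hs1 hT0
  obtain ⟨h1, h2⟩ := integral_rampIncr_add_sq hs hs1 hδ hδ1 (T * ((1 - ε) * ((Λ + 1) / δ)))
    (-(T * (1 / ε - 1)))
  have hnn : ∀ h ∈ Ioi (0 : ℝ), 0 ≤ sqIncr u T h / h ^ (1 + 2 * s) := fun h hh =>
    div_nonneg (intervalIntegral.integral_nonneg hT0.le fun x _ => sq_nonneg _)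
      (Real.rpow_nonneg (le_of_lt hh) _)
  have h3 : ∫ h in Ioc (0 : ℝ) 1, (T * ((1 - ε) * ((Λ + 1) / δ)) * rampIncr δ h +
      -(T * (1 / ε - 1)) * h ^ 2) / h ^ (1 + 2 * s) ≤
      ∫ h in Ioc (0 : ℝ) 1, sqIncr u T h / h ^ (1 + 2 * s) := by
    refine setIntegral_mono_on h1 (hi.mono_set Ioc_subset_Ioi_self) measurableSet_Ioc
      fun h hh => ?_
    have := hu.le_sqIncr hT0 hΛ hδ hε hε1 hh.1.le (hh.2.trans hT)
    have := Real.rpow_pos_of_pos hh.1 (1 + 2 * s)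
    gcongr
    linarith
  have h4 : ∫ h in Ioc (0 : ℝ) 1, sqIncr u T h / h ^ (1 + 2 * s) ≤
      ∫ h in Ioi (0 : ℝ), sqIncr u T h / h ^ (1 + 2 * s) :=
    setIntegral_mono_set hi ((ae_restrict_iff' measurableSet_Ioi).2 (Eventually.of_forall hnn))
      Ioc_subset_Ioi_self.eventuallyLE
  have h5 := (h2 ▸ h3).trans h4
  rw [hF, one_div_mul_eq_div T, le_div_iff₀ hT0]
  refine le_trans (le_of_eq ?_) h5
  have : 2 - 2 * s ≠ 0 := by linarith
  field_simp

  ring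

/-- The `(1 + δ)`-periodic function with slope `-1 / δ` on `(0, δ)` and slope `1` on
`(δ, 1 + δ)` vanishing at `0`. -/
def sawtooth (δ x : ℝ) : ℝ :=
  (1 + δ) * Int.fract (x / (1 + δ)) - (1 / δ + 1) * ramp δ ((1 + δ) * Int.fract (x / (1 + δ)))

section Sawtooth

variable {δ : ℝ}

lemma sawtooth_eq (hδ : 0 < δ) (k : ℤ) {x : ℝ} (h0 : k * (1 + δ) ≤ x)
    (h1 : x ≤ (k + 1) * (1 + δ)) :
    sawtooth δ x = x - k * (1 + δ) - (1 / δ + 1) * ramp δ (x - k * (1 + δ)) := by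
  have hP : 0 < 1 + δ := by linarith
  rcases h1.lt_or_eq with h1 | h1
  · have hfl : ⌊x / (1 + δ)⌋ = k := by
      rw [Int.floor_eq_iff, le_div_iff₀ hP, div_lt_iff₀ hP]
      exact ⟨h0, h1⟩
    have : (1 + δ) * Int.fract (x / (1 + δ)) = x - k * (1 + δ) := by
      rw [Int.fract, hfl]; field_simp
    rw [sawtooth, this]
  · have : x / (1 + δ) = ((k + 1 : ℤ) : ℝ) := by
      rw [h1]; push_cast; field_simp
    rw [sawtooth, this, Int.fract_intCast, mul_zero, ramp_of_nonpos le_rfl,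
      ramp_of_le hδ.le (by linarith), h1]
    field_simp
    ring

lemma exists_int_mul_le (hδ : 0 < δ) (x : ℝ) :
    ∃ k : ℤ, k * (1 + δ) ≤ x ∧ x < (k + 1) * (1 + δ) := by
  have hP : 0 < 1 + δ := by linarith
  exact ⟨⌊x / (1 + δ)⌋, (le_div_iff₀ hP).1 (Int.floor_le _),
    (div_lt_iff₀ hP).1 (Int.lt_floor_add_one _)⟩

lemma continuous_sawtooth (hδ : 0 < δ) : Continuous (sawtooth δ) := by
  have hcr := continuous_ramp δ
  have h := ContinuousOn.comp_fract''
    (f := fun y => (1 + δ) * y - (1 / δ + 1) * ramp δ ((1 + δ) * y))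
    (Continuous.continuousOn (by fun_prop)) (by
      simp only [mul_zero, mul_one]
      rw [ramp_of_nonpos le_rfl, ramp_of_le hδ.le (by linarith)]
      field_simp
      ring)
  exact h.comp (continuous_id.div_const (1 + δ))

lemma periodic_sawtooth (hδ : 0 < δ) : Function.Periodic (sawtooth δ) (1 + δ) := by
  intro x
  have hP : 1 + δ ≠ 0 := by linarith
  rw [sawtooth, sawtooth, add_div, div_self hP, Int.fract_add_one]

lemma sawtooth_mem (hδ : 0 < δ) (x : ℝ) : sawtooth δ x ∈ Icc (-1) 0 := by
  obtain ⟨k, h0, h1⟩ := exists_int_mul_le hδ x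
  rw [sawtooth_eq hδ k h0 h1.le]
  set y := x - k * (1 + δ) with hy
  have hy0 : 0 ≤ y := by linarith
  have hy1 : y ≤ 1 + δ := by linarith
  have hd : 1 / δ * δ = 1 := by field_simp
  rcases le_total y δ with h | h
  · rw [ramp_of_mem hy0 h]
    have h2 : 1 / δ * y ≤ 1 / δ * δ := by gcongr
    have h3 : 0 ≤ 1 / δ * y := by positivity
    constructor <;> linarith
  · rw [ramp_of_le hδ.le h]
    constructor <;> linarith

lemma sawtooth_of_mem_down (hδ : 0 < δ) (k : ℤ) {x : ℝ}
    (hx : x ∈ Ioo (k * (1 + δ)) (k * (1 + δ) + δ)) :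
    sawtooth δ x = -(1 / δ) * x + (1 / δ) * (k * (1 + δ)) := by
  rw [sawtooth_eq hδ k hx.1.le (by linarith [hx.2]),
    ramp_of_mem (by linarith [hx.1]) (by linarith [hx.2])]
  ring

lemma sawtooth_of_mem_up (hδ : 0 < δ) (k : ℤ) {x : ℝ}
    (hx : x ∈ Ioo (k * (1 + δ) + δ) ((k + 1) * (1 + δ))) :
    sawtooth δ x = 1 * x + (-(k * (1 + δ)) - (1 / δ + 1) * δ) := by
  rw [sawtooth_eq hδ k (by linarith [hx.1]) hx.2.le, ramp_of_le hδ.le (by linarith [hx.1])]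
  ring

lemma hasDerivAt_of_eqOn_Ioo {u : ℝ → ℝ} {a b m q x : ℝ} (hx : x ∈ Ioo a b)
    (h : ∀ y ∈ Ioo a b, u y = m * y + q) : HasDerivAt u m x := by
  have h1 : HasDerivAt (fun z => m * z + q) m x := by
    simpa using ((hasDerivAt_id x).const_mul m).add_const q
  refine h1.congr_of_eventuallyEq ?_
  filter_upwards [Ioo_mem_nhds hx.1 hx.2] with y hy using h y hy

/-- The complement of the set of corners of `sawtooth δ`. -/
def sawtoothRegular (δ : ℝ) : Set ℝ :=
  ⋃ k : ℤ, (Ioo (k * (1 + δ)) (k * (1 + δ) + δ) ∪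
    Ioo (k * (1 + δ) + δ) ((k + 1) * (1 + δ)))

lemma eq_or_eq_of_notMem_sawtoothRegular (hδ : 0 < δ) {x : ℝ} (hx : x ∉ sawtoothRegular δ) :
    ∃ k : ℤ, x = k * (1 + δ) ∨ x = k * (1 + δ) + δ := by
  obtain ⟨k, h0, h1⟩ := exists_int_mul_le hδ x
  refine ⟨k, ?_⟩
  by_contra! hne
  refine hx (mem_iUnion.2 ⟨k, ?_⟩)
  rcases hne.2.lt_or_gt with h | h
  · exact Or.inl ⟨lt_of_le_of_ne h0 (Ne.symm hne.1), h⟩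
  · exact Or.inr ⟨h, h1⟩

lemma piecewiseAffine_sawtooth (hδ : 0 < δ) : PiecewiseAffine (sawtooth δ) := by
  refine ⟨(sawtoothRegular δ)ᶜ, ?_, fun x hx => ?_, fun x hx => ?_⟩
  · exact (isOpen_iUnion fun k => isOpen_Ioo.union isOpen_Ioo).isClosed_compl
  · obtain ⟨k, hk⟩ := eq_or_eq_of_notMem_sawtoothRegular hδ hx
    refine ⟨min δ 1, lt_min hδ one_pos, fun y hy => ?_⟩
    have h1 := min_le_left δ 1
    have h2 := min_le_right δ 1
    obtain ⟨hyS, hy1, hy2⟩ := hy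
    by_contra hne
    refine hyS (mem_iUnion.2 ?_)
    rcases hk with hk | hk <;> rcases lt_or_gt_of_ne hne with hlt | hgt
    · refine ⟨k - 1, Or.inr ⟨?_, ?_⟩⟩ <;> push_cast <;> linarith
    · exact ⟨k, Or.inl ⟨by linarith, by linarith⟩⟩
    · exact ⟨k, Or.inl ⟨by linarith, by linarith⟩⟩
    · exact ⟨k, Or.inr ⟨by linarith, by linarith⟩⟩
  · rw [notMem_compl_iff] at hx
    have hloc : ∀ a b m q : ℝ, x ∈ Ioo a b → (∀ y ∈ Ioo a b, sawtooth δ y = m * y + q) →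
        ∃ ε > 0, ∃ m q : ℝ, ∀ y : ℝ, |y - x| < ε → sawtooth δ y = m * y + q := by
      intro a b m q hx h
      obtain ⟨ε, hε, hb⟩ := Metric.isOpen_iff.1 isOpen_Ioo x hx
      exact ⟨ε, hε, m, q, fun y hy => h y (hb hy)⟩
    obtain ⟨k, hk | hk⟩ := mem_iUnion.1 hx
    · exact hloc _ _ _ _ hk fun y hy => sawtooth_of_mem_down hδ k hy
    · exact hloc _ _ _ _ hk fun y hy => sawtooth_of_mem_up hδ k hy

lemma admissible_sawtooth (hδ : 0 < δ) (L : ℕ) :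
    Admissible (L * ((1 / δ + 1) * δ)) (1 / δ) δ (sawtooth δ) := by
  have hP : (1 / δ + 1) * δ = 1 + δ := by field_simp
  have hdown (k : ℤ) : ∀ x ∈ Ioo (k * (1 + δ)) (k * (1 + δ) + δ),
      HasDerivAt (sawtooth δ) (-(1 / δ)) x := fun x hx =>
    hasDerivAt_of_eqOn_Ioo hx fun y hy => sawtooth_of_mem_down hδ k hy
  have hup (k : ℤ) : ∀ x ∈ Ioo (k * (1 + δ) + δ) ((k + 1) * (1 + δ)),
      HasDerivAt (sawtooth δ) 1 x := fun x hx =>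
    hasDerivAt_of_eqOn_Ioo hx fun y hy => sawtooth_of_mem_up hδ k hy
  have hcount : ((sawtoothRegular δ)ᶜ).Countable := by
    refine ((countable_range fun k : ℤ => (k : ℝ) * (1 + δ)).union
      (countable_range fun k : ℤ => (k : ℝ) * (1 + δ) + δ)).mono fun x hx => ?_
    obtain ⟨k, hk | hk⟩ := eq_or_eq_of_notMem_sawtoothRegular hδ hx
    · exact Or.inl ⟨k, hk.symm⟩
    · exact Or.inr ⟨k, hk.symm⟩
  refine ⟨continuous_sawtooth hδ, ?_, piecewiseAffine_sawtooth hδ, ?_, ?_⟩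
  · rw [hP]
    exact (periodic_sawtooth hδ).nat_mul L
  · filter_upwards [hcount.ae_notMem volume] with x hx
    rw [notMem_compl_iff] at hx
    obtain ⟨k, hk | hk⟩ := mem_iUnion.1 hx
    · exact Or.inr (hdown k x hk)
    · exact Or.inl (hup k x hk)
  · obtain ⟨e⟩ : Nonempty (ℕ ≃ ℤ) := ⟨(Denumerable.eqv ℤ).symm⟩
    refine ⟨fun n => (e n : ℝ) * (1 + δ), fun n => hdown (e n), fun x hx => ?_, ?_⟩
    · obtain ⟨k, h0, h1⟩ := exists_int_mul_le hδ x
      refine mem_iUnion.2 ⟨e.symm k, ?_⟩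
      simp only [Equiv.apply_symm_apply]
      refine ⟨h0, not_lt.1 fun hlt => ?_⟩
      have h2 := (hup k x ⟨hlt, h1⟩).unique hx
      have : 0 < 1 / δ := by positivity
      linarith
    · intro i j hij x hx
      exfalso
      have key : ∀ m n : ℤ, m < n → x ∈ Icc (m * (1 + δ)) (m * (1 + δ) + δ) →
          x ∈ Icc (n * (1 + δ)) (n * (1 + δ) + δ) → False := by
        intro m n hmn hm hn
        have h1 : (m : ℝ) + 1 ≤ n := by exact_mod_cast hmn
        have h2 : ((m : ℝ) + 1) * (1 + δ) ≤ n * (1 + δ) := by gcongr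
        linarith [hm.2, hn.1]
      rcases lt_or_gt_of_ne (e.injective.ne hij) with h | h
      · exact key _ _ h hx.1 hx.2
      · exact key _ _ h hx.2 hx.1

lemma sawtooth_eq_of_mem (hδ : 0 < δ) {x : ℝ} (h0 : -1 ≤ x) (h1 : x ≤ 1 + δ) :
    sawtooth δ x = x - (1 / δ + 1) * ramp δ x := by
  rcases le_total x 0 with hx | hx
  · rw [sawtooth_eq hδ (-1) (by push_cast; linarith) (by push_cast; linarith), ramp_of_nonpos hx,
      ramp_of_le hδ.le (by push_cast; linarith)]
    push_cast
    field_simp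
    ring
  · rw [sawtooth_eq hδ 0 (by push_cast; linarith) (by push_cast; linarith)]
    simp

lemma sqIncr_sawtooth_nat_mul (hδ : 0 < δ) (L : ℕ) (h : ℝ) :
    sqIncr (sawtooth δ) (L * (1 + δ)) h = L * sqIncr (sawtooth δ) (1 + δ) h := by
  have hper := periodic_sawtooth hδ
  have hc := continuous_sawtooth hδ
  have hF : Function.Periodic (fun x => (sawtooth δ (x + h) - sawtooth δ x) ^ 2) (1 + δ) := by
    intro x
    simp only
    rw [show x + (1 + δ) + h = x + h + (1 + δ) by ring, hper, hper]
  have h1 := hF.intervalIntegral_add_zsmul_eq L 0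
    (fun _ _ => Continuous.intervalIntegrable (by fun_prop) _ _)
  simpa [sqIncr, mul_add] using h1

lemma sqIncr_sawtooth_le_one_add (hδ : 0 < δ) (h : ℝ) :
    sqIncr (sawtooth δ) (1 + δ) h ≤ 1 + δ := by
  have hc := continuous_sawtooth hδ
  calc sqIncr (sawtooth δ) (1 + δ) h ≤ ∫ x in (0 : ℝ)..(1 + δ), (1 : ℝ) := by
        refine intervalIntegral.integral_mono_on (by linarith)
          (Continuous.intervalIntegrable (by fun_prop) _ _) (by simp) fun x _ => ?_
        have h1 := sawtooth_mem hδ (x + h)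
        have h2 := sawtooth_mem hδ x
        rw [sq_le_one_iff_abs_le_one, abs_le]
        constructor <;> linarith [h1.1, h1.2, h2.1, h2.2]
    _ = 1 + δ := by simp

lemma sqIncr_sawtooth_le (hδ : 0 < δ) {ε h : ℝ} (hε : 0 < ε) (h0 : 0 ≤ h) (h1 : h ≤ 1) :
    sqIncr (sawtooth δ) (1 + δ) h ≤
      (1 + ε) * (1 / δ + 1) ^ 2 * rampIncr δ h + (1 + 1 / ε) * h ^ 2 * (1 + δ) := by
  have hper := periodic_sawtooth hδ
  have hc := continuous_sawtooth hδ
  have hcr := continuous_ramp δ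
  have hF : Function.Periodic (fun x => (sawtooth δ (x + h) - sawtooth δ x) ^ 2) (1 + δ) := by
    intro x
    simp only
    rw [show x + (1 + δ) + h = x + h + (1 + δ) by ring, hper, hper]
  have hshift := hF.intervalIntegral_add_eq 0 (-h)
  rw [zero_add] at hshift
  have hzero : ∫ x in δ..(-h + (1 + δ)), (ramp δ (x + h) - ramp δ x) ^ 2 = 0 := by
    rw [← intervalIntegral.integral_zero (a := δ) (b := -h + (1 + δ)) (E := ℝ)]
    refine intervalIntegral.integral_congr fun x hx => ?_
    rw [uIcc_of_le (by linarith)] at hx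
    simp only [ramp_of_le hδ.le hx.1, ramp_of_le hδ.le (show δ ≤ x + h by linarith [hx.1]),
      sub_self]
    norm_num
  have hramp : ∫ x in (-h)..(-h + (1 + δ)), (ramp δ (x + h) - ramp δ x) ^ 2 = rampIncr δ h := by
    rw [← intervalIntegral.integral_add_adjacent_intervals (intervalIntegrable_ramp δ h (-h) δ)
      (intervalIntegrable_ramp δ h δ _), hzero, add_zero, rampIncr]
  rw [sqIncr, hshift]
  calc ∫ x in (-h)..(-h + (1 + δ)), (sawtooth δ (x + h) - sawtooth δ x) ^ 2
      ≤ ∫ x in (-h)..(-h + (1 + δ)), ((1 + ε) * (1 / δ + 1) ^ 2 * (ramp δ (x + h) - ramp δ x) ^ 2 +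
          (1 + 1 / ε) * h ^ 2) := by
        refine intervalIntegral.integral_mono_on (by linarith)
          (Continuous.intervalIntegrable (by fun_prop) _ _)
          (Continuous.intervalIntegrable (by fun_prop) _ _) fun x hx => ?_
        rw [sawtooth_eq_of_mem hδ (x := x + h) (by linarith [hx.1]) (by linarith [hx.2]),
          sawtooth_eq_of_mem hδ (x := x) (by linarith [hx.1]) (by linarith [hx.2])]
        have := sub_sq_le hε h ((1 / δ + 1) * (ramp δ (x + h) - ramp δ x))
        rw [mul_pow] at this
        calc _ = (h - (1 / δ + 1) * (ramp δ (x + h) - ramp δ x)) ^ 2 := by ring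
          _ ≤ _ := by linarith
    _ = _ := by
        rw [intervalIntegral.integral_add (Continuous.intervalIntegrable (by fun_prop) _ _)
          (by simp), intervalIntegral.integral_const_mul, hramp, intervalIntegral.integral_const,
          smul_eq_mul]
        ring

lemma Fs_sawtooth_le {s ε : ℝ} (hs : 1 / 2 < s) (hs1 : s < 1) (hδ : 0 < δ) (hδ1 : δ ≤ 1)
    (hε : 0 < ε) {L : ℕ} (hL : 0 < L) :
    Fs s (L * ((1 / δ + 1) * δ)) (sawtooth δ) ≤
      (1 + ε) * (1 + δ) * coreEnergy s δ + (1 + 1 / ε) / (2 - 2 * s) + 1 / (2 * s) := by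
  have hP : (1 / δ + 1) * δ = 1 + δ := by field_simp
  have hL' : (0 : ℝ) < L := by exact_mod_cast hL
  have hP0 : 0 < 1 + δ := by linarith
  obtain ⟨hi, hF⟩ := (admissible_sawtooth hδ L).Fs_eq (by linarith) hs1 (by positivity)
  rw [hF]
  rw [hP] at hi ⊢
  simp only [sqIncr_sawtooth_nat_mul hδ L, mul_div_assoc] at hi ⊢
  rw [integral_const_mul, ← mul_assoc, show 1 / (L * (1 + δ)) * (L : ℝ) = 1 / (1 + δ) by field_simp,
    one_div_mul_eq_div, div_le_iff₀ hP0]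
  have hi' : IntegrableOn (fun h => sqIncr (sawtooth δ) (1 + δ) h / h ^ (1 + 2 * s)) (Ioi 0) :=
    (integrable_const_mul_iff (IsUnit.mk0 _ hL'.ne') _).1 hi
  obtain ⟨h1, h2⟩ := integral_rampIncr_add_sq hs hs1 hδ hδ1 ((1 + ε) * (1 / δ + 1) ^ 2)
    ((1 + 1 / ε) * (1 + δ))
  have h3 : ∫ h in Ioc (0 : ℝ) 1, sqIncr (sawtooth δ) (1 + δ) h / h ^ (1 + 2 * s) ≤ _ :=
    (setIntegral_mono_on (hi'.mono_set Ioc_subset_Ioi_self) h1 measurableSet_Ioc fun h hh => by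
      have := sqIncr_sawtooth_le hδ hε hh.1.le hh.2
      have := Real.rpow_pos_of_pos hh.1 (1 + 2 * s)
      gcongr
      linarith).trans_eq h2
  have h4 : IntegrableOn (fun h : ℝ => (1 + δ) * h ^ (-(1 + 2 * s))) (Ioi 1) :=
    (integrableOn_Ioi_rpow_of_lt (by linarith) one_pos).const_mul _
  have h5 : ∫ h in Ioi (1 : ℝ), sqIncr (sawtooth δ) (1 + δ) h / h ^ (1 + 2 * s) ≤
      (1 + δ) * (1 / (2 * s)) := by
    calc _ ≤ ∫ h in Ioi (1 : ℝ), (1 + δ) * h ^ (-(1 + 2 * s)) := by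
          refine setIntegral_mono_on (hi'.mono_set (Ioi_subset_Ioi zero_le_one)) h4
            measurableSet_Ioi fun h hh => ?_
          have hh0 : 0 < h := one_pos.trans hh
          rw [Real.rpow_neg hh0.le, ← div_eq_mul_inv]
          gcongr
          exact sqIncr_sawtooth_le_one_add hδ h
      _ = _ := by
          rw [integral_const_mul, integral_Ioi_rpow_of_lt (by linarith) one_pos, Real.one_rpow,
            show -(1 + 2 * s) + 1 = -(2 * s) by ring, neg_div_neg_eq]
  rw [← Ioc_union_Ioi_eq_Ioi (zero_le_one (α := ℝ)),
    setIntegral_union (Ioc_disjoint_Ioi le_rfl) measurableSet_Ioi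
      (hi'.mono_set Ioc_subset_Ioi_self) (hi'.mono_set (Ioi_subset_Ioi zero_le_one))]
  refine (add_le_add h3 h5).trans_eq ?_
  have e : (1 / δ + 1) ^ 2 * δ ^ 2 = (1 + δ) ^ 2 := by rw [← mul_pow, hP]
  linear_combination (1 + ε) * coreEnergy s δ * e

end Sawtooth

lemma tendsto_coreEnergy_div {s : ℝ} (hs : 1 / 2 < s) (hs1 : s < 1) {δ : ℕ → ℝ}
    (hδpos : ∀ n, 0 < δ n) (hδ0 : Tendsto δ atTop (𝓝 0)) :
    Tendsto (fun n => coreEnergy s (δ n) /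
      (δ n ^ (1 - 2 * s) / (2 * s * (1 - s) * (2 * s - 1) * (3 - 2 * s)))) atTop (𝓝 1) := by
  set κ := 2 * s * (1 - s) * (2 * s - 1) * (3 - 2 * s) with hκdef
  have hκ : 0 < κ := by
    have : 0 < 1 - s := by linarith
    have : 0 < 2 * s - 1 := by linarith
    have : 0 < 3 - 2 * s := by linarith
    positivity
  have hpow : Tendsto (fun n => δ n ^ (2 * s - 1)) atTop (𝓝 0) := by
    have := hδ0.rpow_const (p := 2 * s - 1) (Or.inr (by linarith))
    rwa [Real.zero_rpow (by linarith)] at this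
  have h := ((hδ0.div_const (6 * s)).sub_const (1 / (2 * s - 1))).mul (hpow.mul_const κ)
    |>.const_add 1
  simp only [zero_mul, mul_zero, add_zero] at h
  refine h.congr fun n => ?_
  have h1 := Real.rpow_pos_of_pos (hδpos n) (2 * s - 1)
  have h2 : 2 * s - 1 ≠ 0 := by linarith
  have h3 : s ≠ 0 := by linarith
  rw [coreEnergy, show 1 - 2 * s = -(2 * s - 1) by ring, Real.rpow_neg (hδpos n).le, ← hκdef]
  generalize δ n ^ (2 * s - 1) = p at h1
  generalize κ = k at hκ
  field_simp
  ring

lemma tendsto_of_forall_bounds {F R σ : ℕ → ℝ} (hR : Tendsto (fun n => R n / σ n) atTop (𝓝 1))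
    (hσ : Tendsto σ atTop atTop) {c : ℝ → ℝ}
    (hlow : ∀ ε ∈ Ioc (0 : ℝ) 1, ∀ᶠ n in atTop, (1 - ε) * R n - c ε ≤ F n)
    (hupp : ∀ ε ∈ Ioc (0 : ℝ) 1, ∀ᶠ n in atTop, F n ≤ (1 + ε) * R n + c ε) :
    Tendsto (fun n => F n / σ n) atTop (𝓝 1) := by
  have hlim (a b : ℝ) : Tendsto (fun n => (a * R n + b) / σ n) atTop (𝓝 a) := by
    have h := (hR.const_mul a).add (hσ.inv_tendsto_atTop.const_mul b)
    rw [mul_one, mul_zero, add_zero] at h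
    refine h.congr fun n => ?_
    simp only [Pi.inv_apply]
    ring
  refine tendsto_order.2 ⟨fun b hb => ?_, fun b hb => ?_⟩
  · have hε : min 1 ((1 - b) / 2) ∈ Ioc (0 : ℝ) 1 :=
      ⟨lt_min one_pos (by linarith), min_le_left _ _⟩
    have hb' : b < 1 - min 1 ((1 - b) / 2) := by
      have := min_le_right 1 ((1 - b) / 2)
      linarith
    filter_upwards [hlow _ hε, (hlim _ (-c _)).eventually_const_lt hb', hσ.eventually_gt_atTop 0]
      with n h1 h2 h3
    exact h2.trans_le (by gcongr; linarith)
  · have hε : min 1 ((b - 1) / 2) ∈ Ioc (0 : ℝ) 1 :=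
      ⟨lt_min one_pos (by linarith), min_le_left _ _⟩
    have hb' : 1 + min 1 ((b - 1) / 2) < b := by
      have := min_le_right 1 ((b - 1) / 2)
      linarith
    filter_upwards [hupp _ hε, (hlim _ (c _)).eventually_lt_const hb', hσ.eventually_gt_atTop 0]
      with n h1 h2 h3
    exact lt_of_le_of_lt (by gcongr) h2

/-- asymptotics of the minimal energy for `1/2 < s < 1`. -/
theorem statement5 (s : ℝ) (hs : 1 / 2 < s) (hs1 : s < 1)
    (δ : ℕ → ℝ) (hδpos : ∀ n, 0 < δ n) (hδ0 : Tendsto δ atTop (𝓝 0))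
    (L : ℕ → ℕ) (hL : ∀ n, 0 < L n)
    (T : ℕ → ℝ) (hT : ∀ n, T n = (L n : ℝ) * ((1 / δ n + 1) * δ n))
    (u : ℕ → ℝ → ℝ) (hadm : ∀ n, Admissible (T n) (1 / δ n) (δ n) (u n))
    (hmin : ∀ n, ∀ v : ℝ → ℝ, Admissible (T n) (1 / δ n) (δ n) v →
      Fs s (T n) (u n) ≤ Fs s (T n) v) :
    Tendsto (fun n => Fs s (T n) (u n) /
        ((δ n) ^ (1 - 2 * s) / (2 * s * (1 - s) * (2 * s - 1) * (3 - 2 * s))))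
      atTop (𝓝 1) := by
  have hP (n : ℕ) : (1 / δ n + 1) * δ n = 1 + δ n := by
    have := (hδpos n).ne'
    field_simp
  have hδ1 : ∀ᶠ n in atTop, δ n ≤ 1 := (hδ0.eventually_lt_const one_pos).mono fun n h => h.le
  have hσ : Tendsto (fun n => (δ n) ^ (1 - 2 * s) /
      (2 * s * (1 - s) * (2 * s - 1) * (3 - 2 * s))) atTop atTop := by
    have h1 : 0 < 1 - s := by linarith
    have h2 : 0 < 2 * s - 1 := by linarith
    have h3 : 0 < 3 - 2 * s := by linarith
    refine Tendsto.atTop_div_const (by positivity) ?_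
    exact (tendsto_rpow_neg_nhdsGT_zero (by linarith)).comp
      (tendsto_nhdsWithin_iff.2 ⟨hδ0, Eventually.of_forall hδpos⟩)
  have hR : Tendsto (fun n => (1 + δ n) * coreEnergy s (δ n) / ((δ n) ^ (1 - 2 * s) /
      (2 * s * (1 - s) * (2 * s - 1) * (3 - 2 * s)))) atTop (𝓝 1) := by
    have h := (hδ0.const_add 1).mul (tendsto_coreEnergy_div hs hs1 hδpos hδ0)
    rw [add_zero, one_mul] at h
    exact h.congr fun n => by rw [mul_div_assoc]
  have hs2 : 0 < 2 - 2 * s := by linarith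
  refine tendsto_of_forall_bounds hR hσ
    (c := fun ε => (1 + 1 / ε) / (2 - 2 * s) + 1 / (2 * s)) ?_ ?_
  · intro ε hε
    filter_upwards [hδ1] with n hn
    have hL1 : (1 : ℝ) ≤ L n := by exact_mod_cast hL n
    have hT1 : 1 ≤ T n := by
      rw [hT, hP]
      nlinarith [hδpos n]
    have h := (hadm n).le_Fs hs hs1 hT1 (one_div_pos.2 (hδpos n)) (hδpos n) hn hε.1 hε.2
    rw [hP] at h
    refine le_trans ?_ h
    have h4 : (1 / ε - 1) / (2 - 2 * s) ≤ (1 + 1 / ε) / (2 - 2 * s) := by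
      gcongr
      linarith
    have h5 : 0 < 1 / (2 * s) := by positivity
    linarith
  · intro ε hε
    filter_upwards [hδ1] with n hn
    have h := hmin n _ (by rw [hT n]; exact admissible_sawtooth (hδpos n) (L n))
    have h2 := Fs_sawtooth_le hs hs1 (hδpos n) hn hε.1 (hL n)
    rw [← hT n] at h2
    linarith
end
end

section
/- Let Λ, δ > 0 and T = L(Λ+1)δ for some positive integer L. The minimizers of ℱ^T_0 over 𝒜^{T,Λ,δ} are exactly the functions x ↦ ū(x − x₀) − Λδ/2 with x₀ ∈ ℝ. -/
open MeasureTheory Filter Set Topology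

noncomputable section

/-- The intervals `[a k, a k + δ]` describe the region where `u` has slope `-Λ`. -/
structure IsNegFamily (Λ δ : ℝ) (u : ℝ → ℝ) (a : ℕ → ℝ) : Prop where
  sub : ∀ k : ℕ, Ioo (a k) (a k + δ) ⊆ {x : ℝ | HasDerivAt u (-Λ) x}
  cover : {x : ℝ | HasDerivAt u (-Λ) x} ⊆ ⋃ k : ℕ, Icc (a k) (a k + δ)
  disj : Pairwise fun i j : ℕ => (Icc (a i) (a i + δ) ∩ Icc (a j) (a j + δ)).Subsingleton

theorem PiecewiseAffine.exists_countable_differentiableAt {u : ℝ → ℝ} (h : PiecewiseAffine u) :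
    ∃ S : Set ℝ, S.Countable ∧ ∀ x ∉ S, DifferentiableAt ℝ u x := by
  obtain ⟨S, -, hiso, haff⟩ := h
  refine ⟨S, ?_, fun x hx => ?_⟩
  · refine (HereditarilyLindelofSpace.isLindelof S).countable_of_isDiscrete ?_
    rw [isDiscrete_iff_forall_mem_exists_isOpen]
    intro x hx
    obtain ⟨ε, hε, h⟩ := hiso x hx
    refine ⟨Ioo (x - ε) (x + ε), isOpen_Ioo, Subset.antisymm ?_ ?_⟩
    · rwa [inter_comm]
    · rintro _ rfl
      exact ⟨⟨by linarith, by linarith⟩, hx⟩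
  · obtain ⟨ε, hε, m, q, h⟩ := haff x hx
    have hlin : DifferentiableAt ℝ (fun y => m * y + q) x := by fun_prop
    refine hlin.congr_of_eventuallyEq ?_
    filter_upwards [Metric.ball_mem_nhds x hε] with y hy
    exact h y (by rwa [Metric.mem_ball, Real.dist_eq] at hy)

namespace IsNegFamily

variable {Λ δ T : ℝ} {u : ℝ → ℝ} {a : ℕ → ℝ}

/-- Two members of the family overlapping in an open interval coincide. -/
theorem eq_of_lt (ha : IsNegFamily Λ δ u a) {i j : ℕ} (h₁ : a i ≤ a j) (h₂ : a j < a i + δ) :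
    i = j := by
  by_contra hij
  have hsub : (Icc (a i) (a i + δ) ∩ Icc (a j) (a j + δ)).Subsingleton := ha.disj hij
  have := @hsub (a j) ⟨⟨h₁, h₂.le⟩, ⟨le_rfl, by linarith⟩⟩ (a i + δ)
    ⟨⟨by linarith, le_rfl⟩, ⟨h₂.le, by linarith⟩⟩
  linarith

theorem pairwise_disjoint (ha : IsNegFamily Λ δ u a) :
    Pairwise (Function.onFun Disjoint fun k => Ioo (a k) (a k + δ)) := by
  intro i j hij
  refine Set.disjoint_left.2 fun x hi hj => hij ?_
  rcases le_total (a i) (a j) with h | h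
  · exact ha.eq_of_lt h (hj.1.trans hi.2)
  · exact (ha.eq_of_lt h (hi.1.trans hj.2)).symm

/-- Almost everywhere, the slope is `-Λ` inside the family and `1` outside of it. -/
theorem ae_deriv (ha : IsNegFamily Λ δ u a)
    (hs : ∀ᵐ x : ℝ ∂volume, HasDerivAt u 1 x ∨ HasDerivAt u (-Λ) x) :
    ∀ᵐ x : ℝ ∂volume,
      deriv u x = 1 - (1 + Λ) * (⋃ k, Ioo (a k) (a k + δ)).indicator 1 x := by
  have hc : (range a ∪ range fun k => a k + δ).Countable :=
    (countable_range _).union (countable_range _)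
  filter_upwards [hs, hc.ae_notMem volume] with x hx hxc
  by_cases hG : x ∈ ⋃ k, Ioo (a k) (a k + δ)
  · obtain ⟨k, hk⟩ := mem_iUnion.1 hG
    rw [indicator_of_mem hG, (show HasDerivAt u (-Λ) x from ha.sub k hk).deriv]
    simp
  · rw [indicator_of_notMem hG]
    rcases hx with h | h
    · simp [h.deriv]
    · obtain ⟨k, hk⟩ := mem_iUnion.1 (ha.cover h)
      have hne : x ∉ Ioo (a k) (a k + δ) := fun h => hG (mem_iUnion.2 ⟨k, h⟩)
      refine absurd ⟨lt_of_le_of_ne hk.1 ?_, lt_of_le_of_ne hk.2 ?_⟩ hne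
      · exact fun h => hxc (Or.inl ⟨k, h⟩)
      · exact fun h => hxc (Or.inr ⟨k, h.symm⟩)

theorem measurableSet_iUnion_Ioo : MeasurableSet (⋃ k, Ioo (a k) (a k + δ)) :=
  MeasurableSet.iUnion fun _ => measurableSet_Ioo

/-- The fundamental theorem of calculus for `Q ∘ u`. -/
theorem integral_comp (ha : IsNegFamily Λ δ u a) (hu : Admissible T Λ δ u) {Q q : ℝ → ℝ}
    (hQ : ∀ t, HasDerivAt Q (q t) t) (hq : Continuous q) {x y : ℝ} (hxy : x ≤ y) :
    (∫ t in x..y, q (u t)) - (1 + Λ) * ∫ t in Ioc x y ∩ ⋃ k, Ioo (a k) (a k + δ), q (u t)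
      = Q (u y) - Q (u x) := by
  obtain ⟨S, hS, hdiff⟩ := hu.pwAffine.exists_countable_differentiableAt
  have hqu : Continuous fun t => q (u t) := hq.comp hu.cont
  have hGm := measurableSet_iUnion_Ioo (a := a) (δ := δ)
  have hderiv := ha.ae_deriv hu.slopes
  set G := ⋃ k, Ioo (a k) (a k + δ)
  have hI₁ : IntervalIntegrable (fun t => q (u t)) volume x y := hqu.intervalIntegrable _ _
  have hI₂ : IntervalIntegrable (G.indicator fun t => q (u t)) volume x y := by
    rw [intervalIntegrable_iff_integrableOn_Ioc_of_le hxy] at hI₁ ⊢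
    exact hI₁.indicator hGm
  have hI := hI₁.sub (hI₂.const_mul (1 + Λ))
  have hae : ∀ᵐ t : ℝ ∂volume, q (u t) - (1 + Λ) * G.indicator (fun t => q (u t)) t
      = q (u t) * deriv u t := by
    filter_upwards [hderiv] with t ht
    rw [ht]
    by_cases hG : t ∈ G
    · simp only [indicator_of_mem hG, Pi.one_apply]
      ring
    · simp only [indicator_of_notMem hG]
      ring
  have hmain := integral_eq_of_hasDerivAt_off_countable_of_le (fun t => Q (u t))
    (fun t => q (u t) * deriv u t) hxy hS
    ((continuous_iff_continuousAt.2 fun t => (hQ t).continuousAt).comp hu.cont).continuousOn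
    (fun t ht => (hQ (u t)).comp t (hdiff t ht.2).hasDerivAt)
    (hI.congr_ae (ae_restrict_of_ae hae))
  rw [← hmain, ← intervalIntegral.integral_congr_ae (hae.mono fun t ht _ => ht),
    intervalIntegral.integral_sub hI₁ (hI₂.const_mul _), intervalIntegral.integral_const_mul,
    intervalIntegral.integral_of_le hxy (f := G.indicator _), setIntegral_indicator hGm]

theorem sub_eq (ha : IsNegFamily Λ δ u a) (hu : Admissible T Λ δ u) {x y : ℝ} (hxy : x ≤ y) :
    u y - u x = y - x - (1 + Λ) * volume.real (Ioc x y ∩ ⋃ k, Ioo (a k) (a k + δ)) := by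
  have h := ha.integral_comp hu (Q := id) (q := fun _ => 1) (fun t => hasDerivAt_id t)
    continuous_const hxy
  simp at h
  rw [← h]

theorem sub_le (ha : IsNegFamily Λ δ u a) (hu : Admissible T Λ δ u) (hΛ : 0 < Λ) {x y : ℝ}
    (hxy : x ≤ y) : u y - u x ≤ y - x := by
  rw [ha.sub_eq hu hxy]
  have : 0 ≤ (1 + Λ) * volume.real (Ioc x y ∩ ⋃ k, Ioo (a k) (a k + δ)) := by positivity
  linarith

theorem sub_eq_of_disjoint (ha : IsNegFamily Λ δ u a) (hu : Admissible T Λ δ u) {x y : ℝ}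
    (hxy : x ≤ y) (h : ∀ k, Disjoint (Ioo x y) (Ioo (a k) (a k + δ))) : u y - u x = y - x := by
  have h0 : volume.real (Ioc x y ∩ ⋃ k, Ioo (a k) (a k + δ)) = 0 := by
    have hsub : Ioc x y ∩ ⋃ k, Ioo (a k) (a k + δ) ⊆ {y} := by
      rintro t ⟨ht, htG⟩
      obtain ⟨k, hk⟩ := mem_iUnion.1 htG
      by_contra hne
      exact Set.disjoint_left.1 (h k) ⟨ht.1, lt_of_le_of_ne ht.2 hne⟩ hk
    rw [measureReal_def, measure_mono_null hsub (by simp)]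
    rfl
  rw [ha.sub_eq hu hxy, h0]
  ring

theorem eqOn (ha : IsNegFamily Λ δ u a) (hu : Continuous u) (k : ℕ) {x : ℝ}
    (hx : x ∈ Icc (a k) (a k + δ)) : u x = u (a k) - Λ * (x - a k) := by
  have h := intervalIntegral.integral_eq_sub_of_hasDerivAt_of_le hx.1 hu.continuousOn
    (f' := fun _ => -Λ) (fun t ht => ha.sub k ⟨ht.1, ht.2.trans_le hx.2⟩) (by simp)
  simp at h
  linarith

/-- The mean value of `u` on the `k`-th interval controls its energy there. -/
theorem integral_Ioo (ha : IsNegFamily Λ δ u a) (hu : Continuous u) (hδ : 0 < δ) (k : ℕ) :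
    ∫ t in Ioo (a k) (a k + δ), (u t ^ 2 - Λ ^ 2 * δ ^ 2 / 12)
      = δ * (u (a k) - Λ * δ / 2) ^ 2 := by
  rw [← integral_Ioc_eq_integral_Ioo, ← intervalIntegral.integral_of_le (by linarith)]
  set A := u (a k)
  set C := Λ ^ 2 * δ ^ 2 / 12 with hC
  have hd : ∀ t, HasDerivAt (fun t => (A ^ 2 - C) * (t - a k) - A * Λ * (t - a k) ^ 2
      + Λ ^ 2 / 3 * (t - a k) ^ 3) ((A - Λ * (t - a k)) ^ 2 - C) t := by
    intro t
    have h1 := (hasDerivAt_id t).sub_const (a k)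
    refine (((h1.const_mul (A ^ 2 - C)).sub ((h1.pow 2).const_mul (A * Λ))).add
      ((h1.pow 3).const_mul (Λ ^ 2 / 3))).congr_deriv ?_
    simp only [id]
    ring
  have hcongr : EqOn (fun t => u t ^ 2 - C) (fun t => (A - Λ * (t - a k)) ^ 2 - C)
      (uIcc (a k) (a k + δ)) := by
    intro t ht
    rw [uIcc_of_le (by linarith)] at ht
    simp only [ha.eqOn hu k ht, A]
  rw [intervalIntegral.integral_congr hcongr,
    intervalIntegral.integral_eq_sub_of_hasDerivAt (fun t _ => hd t)
      (Continuous.intervalIntegrable (by fun_prop) _ _), hC]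
  ring

theorem notMem_Ioo (ha : IsNegFamily Λ δ u a) {p : ℝ} (hp : ¬HasDerivAt u (-Λ) p) (k : ℕ) :
    p ∉ Ioo (a k) (a k + δ) :=
  fun h => hp (ha.sub k h)

/-- The energy excess of `u` is a sum over the intervals contained in one period. -/
theorem hasSum_energy (ha : IsNegFamily Λ δ u a) (hu : Admissible T Λ δ u) (hΛ : 0 < Λ)
    (hδ : 0 < δ) (hT : 0 < T) {p : ℝ} (hp : ¬HasDerivAt u (-Λ) p) :
    HasSum (fun k => (Ico p (p + T)).indicator (fun s => δ * (u s - Λ * δ / 2) ^ 2) (a k))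
      (2 * T / (1 + Λ) * (F0 T u - Λ ^ 2 * δ ^ 2 / 24)) := by
  have hpT : ¬HasDerivAt u (-Λ) (p + T) := by
    intro h
    have h' := h.comp_add_const p T
    rw [show (fun x => u (x + T)) = u from funext hu.per] at h'
    exact hp h'
  set C := Λ ^ 2 * δ ^ 2 / 12 with hC
  have hg : Continuous fun t => u t ^ 2 - C := (hu.cont.pow 2).sub continuous_const
  have henergy : (∫ t in p..p + T, (u t ^ 2 - C))
      = 2 * T * (F0 T u - Λ ^ 2 * δ ^ 2 / 24) := by
    have hper : Function.Periodic (fun t => u t ^ 2 - C) T := fun t => by simp only [hu.per t]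
    rw [hper.intervalIntegral_add_eq p 0, zero_add, intervalIntegral.integral_sub
      (Continuous.intervalIntegrable (by have := hu.cont; fun_prop) _ _) (by simp), F0,
      ← integral_Ioc_eq_integral_Ioo,
      ← intervalIntegral.integral_of_le hT.le, intervalIntegral.integral_const, hC]
    field_simp
    simp
    ring
  have hftc := ha.integral_comp hu (Q := fun t => t ^ 3 / 3 - C * t) (q := fun t => t ^ 2 - C)
    (fun t => by
      refine ((hasDerivAt_pow 3 t).div_const 3 |>.sub
        ((hasDerivAt_id t).const_mul C)).congr_deriv ?_
      norm_num)
    (by fun_prop) (show p ≤ p + T by linarith)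
  rw [hu.per p, sub_self, henergy, sub_eq_zero, inter_iUnion] at hftc
  have hsum := hasSum_integral_iUnion (f := fun t => u t ^ 2 - C) (μ := volume)
    (s := fun k => Ioc p (p + T) ∩ Ioo (a k) (a k + δ))
    (fun k => measurableSet_Ioc.inter measurableSet_Ioo)
    (fun i j hij => (ha.pairwise_disjoint hij).mono inter_subset_right inter_subset_right)
    ((hg.integrableOn_Ioc (a := p) (b := p + T)).mono_set
      (iUnion_subset fun k => inter_subset_left))
  have hval : (∫ t in ⋃ k, Ioc p (p + T) ∩ Ioo (a k) (a k + δ), (u t ^ 2 - C))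
      = 2 * T / (1 + Λ) * (F0 T u - Λ ^ 2 * δ ^ 2 / 24) := by
    field_simp
    linarith
  rw [hval] at hsum
  have hterm : ∀ k, (∫ t in Ioc p (p + T) ∩ Ioo (a k) (a k + δ), (u t ^ 2 - C))
      = (Ico p (p + T)).indicator (fun s => δ * (u s - Λ * δ / 2) ^ 2) (a k) := by
    intro k
    have h₁ := ha.notMem_Ioo hp k
    have h₂ := ha.notMem_Ioo hpT k
    simp only [mem_Ioo, not_and, not_lt] at h₁ h₂
    by_cases hk : a k ∈ Ico p (p + T)
    · have hsub : Ioo (a k) (a k + δ) ⊆ Ioc p (p + T) :=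
        fun t ht => ⟨hk.1.trans_lt ht.1, ht.2.le.trans (h₂ hk.2)⟩
      rw [indicator_of_mem hk, ← ha.integral_Ioo hu.cont hδ k, inter_eq_self_of_subset_right hsub]
    · have hempty : Ioc p (p + T) ∩ Ioo (a k) (a k + δ) = ∅ := by
        refine eq_empty_of_forall_notMem fun t ⟨ht, htk⟩ => hk ⟨?_, htk.1.trans_le ht.2⟩
        by_contra! h
        linarith [h₁ h, ht.1, htk.2]
      rw [indicator_of_notMem hk, hempty, setIntegral_empty]
  simpa only [hterm] using hsum

theorem exists_not_hasDerivAt (hu : Function.Periodic u T) (hΛ : 0 < Λ) (hT : 0 < T) :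
    ∃ p, ¬HasDerivAt u (-Λ) p := by
  by_contra! h
  have h1 := intervalIntegral.integral_eq_sub_of_hasDerivAt (a := 0) (b := T)
    (fun t _ => h t) (by simp)
  have h2 := hu 0
  rw [zero_add] at h2
  simp [h2] at h1
  rcases h1 with h1 | h1 <;> linarith

theorem le_F0 (ha : IsNegFamily Λ δ u a) (hu : Admissible T Λ δ u) (hΛ : 0 < Λ)
    (hδ : 0 < δ) (hT : 0 < T) : Λ ^ 2 * δ ^ 2 / 24 ≤ F0 T u := by
  obtain ⟨p, hp⟩ := exists_not_hasDerivAt hu.per hΛ hT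
  have h := (ha.hasSum_energy hu hΛ hδ hT hp).nonneg
    fun k => indicator_nonneg (fun s _ => by positivity) _
  have hc : 0 < 2 * T / (1 + Λ) := by positivity
  linarith [nonneg_of_mul_nonneg_right h hc]

theorem F0_eq_iff (ha : IsNegFamily Λ δ u a) (hu : Admissible T Λ δ u) (hΛ : 0 < Λ)
    (hδ : 0 < δ) (hT : 0 < T) :
    F0 T u = Λ ^ 2 * δ ^ 2 / 24 ↔ ∀ k, u (a k) = Λ * δ / 2 := by
  obtain ⟨p, hp⟩ := exists_not_hasDerivAt hu.per hΛ hT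
  constructor
  · intro h k
    obtain ⟨n, hn, -⟩ := existsUnique_sub_zsmul_mem_Ico hT (a k) p
    have hp' : ¬HasDerivAt u (-Λ) (p + n • T) := by
      intro h
      have h' := h.comp_add_const p (n • T)
      rw [show (fun x => u (x + n • T)) = u from funext (hu.per.zsmul n)] at h'
      exact hp h'
    have hsum := ha.hasSum_energy hu hΛ hδ hT hp'
    rw [h, sub_self, mul_zero, hasSum_zero_iff_of_nonneg
      fun k => indicator_nonneg (fun s _ => by positivity) _] at hsum
    have hk := congrFun hsum k
    have hmem : a k ∈ Ico (p + n • T) (p + n • T + T) := ⟨by linarith [hn.1], by linarith [hn.2]⟩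
    rw [indicator_of_mem hmem] at hk
    have : (u (a k) - Λ * δ / 2) ^ 2 = 0 := by simpa [hδ.ne'] using hk
    linarith [pow_eq_zero_iff two_ne_zero |>.1 this]
  · intro h
    have hsum := ha.hasSum_energy hu hΛ hδ hT hp
    have h0 : (fun k => (Ico p (p + T)).indicator
        (fun s => δ * (u s - Λ * δ / 2) ^ 2) (a k)) = fun _ => 0 := by
      funext k
      by_cases hk : a k ∈ Ico p (p + T)
      · rw [indicator_of_mem hk, h k]
        ring
      · rw [indicator_of_notMem hk]
    rw [h0] at hsum
    have hc : 2 * T / (1 + Λ) ≠ 0 := by positivity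
    linarith [(mul_eq_zero_iff_left hc).1 (hsum.unique hasSum_zero)]

/-- After each interval of the family, `u` rises with slope `1` back to its top value. -/
theorem eq_of_mem_rise (ha : IsNegFamily Λ δ u a) (hu : Admissible T Λ δ u) (hΛ : 0 < Λ)
    (hδ : 0 < δ) (hval : ∀ k, u (a k) = Λ * δ / 2) (k : ℕ) {x : ℝ}
    (hx : x ∈ Icc (a k + δ) (a k + (Λ + 1) * δ)) :
    u x = x - (a k + δ) - Λ * δ / 2 := by
  have hb : u (a k + δ) = -(Λ * δ / 2) := by
    rw [ha.eqOn hu.cont k ⟨by linarith, le_rfl⟩, hval k]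
    ring
  have h := ha.sub_eq_of_disjoint hu hx.1 fun j => Set.disjoint_left.2 fun t ht htj => by
    rcases le_or_gt (a k + δ) (a j) with h | h
    · have := ha.sub_le hu hΛ h
      rw [hb, hval j] at this
      linarith [ht.2, htj.1, hx.2]
    · have hkj : a k < a j := by linarith [ht.1, htj.2]
      rw [ha.eq_of_lt hkj.le h] at hkj
      exact lt_irrefl _ hkj
  rw [hb] at h
  linarith

theorem le_top (ha : IsNegFamily Λ δ u a) (hu : Admissible T Λ δ u) (hΛ : 0 < Λ)
    (hval : ∀ k, u (a k) = Λ * δ / 2) (hT : 0 < T) (x : ℝ) : u x ≤ Λ * δ / 2 := by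
  obtain ⟨x₀, -, hmax⟩ := isCompact_Icc.exists_isMaxOn (nonempty_Icc.2 hT.le)
    (hu.cont.continuousOn (s := Icc 0 T))
  have hmax' : ∀ y, u y ≤ u x₀ := fun y => by
    obtain ⟨z, hz, hyz⟩ := hu.per.exists_mem_Ico₀ hT y
    exact hyz ▸ hmax (Ico_subset_Icc_self hz)
  refine (hmax' x).trans ?_
  by_contra! hlt
  obtain ⟨ε, hε, hsub⟩ := Metric.eventually_nhds_iff.1
    (hu.cont.continuousAt.eventually (lt_mem_nhds hlt))
  have h := ha.sub_eq_of_disjoint hu (show x₀ ≤ x₀ + ε by linarith) fun j =>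
    Set.disjoint_left.2 fun t ht htj => by
      have h₁ : Λ * δ / 2 < u t := hsub (by
        rw [Real.dist_eq, abs_lt]
        exact ⟨by linarith [ht.1], by linarith [ht.2]⟩)
      rw [ha.eqOn hu.cont j (Ioo_subset_Icc_self htj), hval j] at h₁
      nlinarith [htj.1]
  linarith [hmax' (x₀ + ε)]

theorem exists_next (ha : IsNegFamily Λ δ u a) (hu : Admissible T Λ δ u) (hΛ : 0 < Λ)
    (hδ : 0 < δ) (hval : ∀ k, u (a k) = Λ * δ / 2) (hT : 0 < T) (k : ℕ) :
    ∃ j, a j = a k + (Λ + 1) * δ := by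
  have htop : ∀ y, u y ≤ Λ * δ / 2 := ha.le_top hu hΛ hval hT
  set c := a k + (Λ + 1) * δ with hc
  have huc : u c = Λ * δ / 2 := by
    rw [ha.eq_of_mem_rise hu hΛ hδ hval k ⟨by nlinarith, le_rfl⟩]
    ring
  have hnext : ∀ x > c, ∃ j, c ≤ a j ∧ a j < x := by
    intro x hx
    by_contra! hcon
    have h := ha.sub_eq_of_disjoint hu hx.le fun j => Set.disjoint_left.2 fun t ht htj => by
      rcases le_or_gt c (a j) with h | h
      · linarith [hcon j h, ht.2, htj.1]
      · have := ha.eqOn hu.cont j (x := c) ⟨h.le, by linarith [ht.1, htj.2]⟩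
        rw [huc, hval j] at this
        nlinarith
    linarith [htop x]
  obtain ⟨j, hj₁, hj₂⟩ := hnext (c + δ) (by linarith)
  refine ⟨j, le_antisymm ?_ hj₁⟩
  by_contra! hlt
  obtain ⟨i, hi₁, hi₂⟩ := hnext (a j) hlt
  rw [ha.eq_of_lt hi₂.le (by linarith)] at hi₂
  exact lt_irrefl _ hi₂

theorem exists_add_mul (ha : IsNegFamily Λ δ u a) (hu : Admissible T Λ δ u) (hΛ : 0 < Λ)
    (hδ : 0 < δ) (hval : ∀ k, u (a k) = Λ * δ / 2) (hT : 0 < T) (k n : ℕ) :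
    ∃ j, a j = a k + n * ((Λ + 1) * δ) := by
  induction n with
  | zero => exact ⟨k, by simp⟩
  | succ n ih =>
    obtain ⟨i, hi⟩ := ih
    obtain ⟨j, hj⟩ := ha.exists_next hu hΛ hδ hval hT i
    exact ⟨j, by rw [hj, hi]; push_cast; ring⟩

end IsNegFamily

section Ubar

variable {Λ δ : ℝ}

theorem ubar_eq_max (hΛ : 0 < Λ) (hδ : 0 < δ) (n : ℤ) {x : ℝ}
    (hx : x ∈ Ico (n * ((Λ + 1) * δ) - δ) (n * ((Λ + 1) * δ) + Λ * δ)) :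
    ubar Λ δ x = max (-Λ * (x - n * ((Λ + 1) * δ))) (x - n * ((Λ + 1) * δ)) := by
  have hP : 0 < (Λ + 1) * δ := by positivity
  have hfr : Int.fract ((x + δ) / ((Λ + 1) * δ)) = (x + δ) / ((Λ + 1) * δ) - n := by
    rw [Int.fract, Int.floor_eq_iff.2 ⟨?_, ?_⟩]
    · rw [le_div_iff₀ hP]
      linarith [hx.1]
    · rw [div_lt_iff₀ hP]
      linarith [hx.2]
  have hy : (Λ + 1) * δ * Int.fract ((x + δ) / ((Λ + 1) * δ)) - δ = x - n * ((Λ + 1) * δ) := by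
    rw [hfr]
    field_simp
    ring
  simp only [ubar, hy]
  set y := x - n * ((Λ + 1) * δ)
  split_ifs with h
  · rw [max_eq_left]
    nlinarith
  · rw [max_eq_right]
    nlinarith

theorem exists_mem_Ico_ubar (hΛ : 0 < Λ) (hδ : 0 < δ) (x : ℝ) :
    ∃ n : ℤ, x ∈ Ico (n * ((Λ + 1) * δ) - δ) (n * ((Λ + 1) * δ) + Λ * δ) := by
  have hP : 0 < (Λ + 1) * δ := by positivity
  refine ⟨⌊(x + δ) / ((Λ + 1) * δ)⌋, ?_, ?_⟩
  · linarith [(le_div_iff₀ hP).1 (Int.floor_le ((x + δ) / ((Λ + 1) * δ)))]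
  · linarith [(div_lt_iff₀ hP).1 (Int.lt_floor_add_one ((x + δ) / ((Λ + 1) * δ)))]

theorem ubar_mem_Icc (hΛ : 0 < Λ) (hδ : 0 < δ) (x : ℝ) : ubar Λ δ x ∈ Icc 0 (Λ * δ) := by
  obtain ⟨n, hn⟩ := exists_mem_Ico_ubar hΛ hδ x
  rw [ubar_eq_max hΛ hδ n hn]
  set y := x - n * ((Λ + 1) * δ) with hy
  have h₁ : -δ ≤ y := by linarith [hn.1]
  have h₂ : y < Λ * δ := by linarith [hn.2]
  refine ⟨?_, max_le (by nlinarith) h₂.le⟩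
  rcases le_total y 0 with h | h
  · exact le_max_of_le_left (by nlinarith)
  · exact le_max_of_le_right h

theorem continuous_ubar (hΛ : 0 < Λ) (hδ : 0 < δ) : Continuous (ubar Λ δ) := by
  have hcont : Continuous fun s : ℝ =>
      max (-Λ * ((Λ + 1) * δ * s - δ)) ((Λ + 1) * δ * s - δ) := by fun_prop
  have h := (hcont.continuousOn.comp_fract'' ?_).comp
    (show Continuous fun x : ℝ => (x + δ) / ((Λ + 1) * δ) by fun_prop)
  · refine h.congr fun x => ?_
    simp only [ubar, Function.comp]
    set y := (Λ + 1) * δ * Int.fract ((x + δ) / ((Λ + 1) * δ)) - δ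
    split_ifs with h
    · rw [max_eq_left]
      nlinarith
    · rw [max_eq_right]
      nlinarith
  · rw [max_eq_left (by nlinarith), max_eq_right (by nlinarith [mul_pos hΛ hδ])]
    ring

theorem ubar_eq_left (hΛ : 0 < Λ) (hδ : 0 < δ) (n : ℤ) {x : ℝ}
    (hx : x ∈ Icc (n * ((Λ + 1) * δ) - δ) (n * ((Λ + 1) * δ))) :
    ubar Λ δ x = -Λ * (x - n * ((Λ + 1) * δ)) := by
  rw [ubar_eq_max hΛ hδ n ⟨hx.1, by nlinarith [hx.2]⟩, max_eq_left]
  nlinarith [hx.2]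

theorem ubar_eq_right (hΛ : 0 < Λ) (hδ : 0 < δ) (n : ℤ) {x : ℝ}
    (hx : x ∈ Ico (n * ((Λ + 1) * δ)) (n * ((Λ + 1) * δ) + Λ * δ)) :
    ubar Λ δ x = x - n * ((Λ + 1) * δ) := by
  rw [ubar_eq_max hΛ hδ n ⟨by linarith [hx.1], hx.2⟩, max_eq_right]
  nlinarith [hx.1]

theorem hasDerivAt_ubar_left (hΛ : 0 < Λ) (hδ : 0 < δ) (n : ℤ) {x : ℝ}
    (hx : x ∈ Ioo (n * ((Λ + 1) * δ) - δ) (n * ((Λ + 1) * δ))) :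
    HasDerivAt (ubar Λ δ) (-Λ) x := by
  have h : HasDerivAt (fun y => -Λ * (y - n * ((Λ + 1) * δ))) (-Λ) x := by
    simpa using ((hasDerivAt_id x).sub_const (n * ((Λ + 1) * δ))).const_mul (-Λ)
  refine h.congr_of_eventuallyEq ?_
  filter_upwards [isOpen_Ioo.mem_nhds hx] with y hy
  exact ubar_eq_left hΛ hδ n (Ioo_subset_Icc_self hy)

theorem hasDerivAt_ubar_right (hΛ : 0 < Λ) (hδ : 0 < δ) (n : ℤ) {x : ℝ}
    (hx : x ∈ Ioo (n * ((Λ + 1) * δ)) (n * ((Λ + 1) * δ) + Λ * δ)) :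
    HasDerivAt (ubar Λ δ) 1 x := by
  refine ((hasDerivAt_id x).sub_const (n * ((Λ + 1) * δ))).congr_of_eventuallyEq ?_
  filter_upwards [isOpen_Ioo.mem_nhds hx] with y hy
  exact ubar_eq_right hΛ hδ n (Ioo_subset_Ico_self hy)

theorem intCast_mul_eq_zero_or_le_or_le_neg {P : ℝ} (hP : 0 < P) (k : ℤ) :
    k * P = 0 ∨ P ≤ k * P ∨ k * P ≤ -P := by
  rcases lt_trichotomy k 0 with h | rfl | h
  · have : (k : ℝ) ≤ -1 := by exact_mod_cast (by lia : k ≤ -1)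
    exact Or.inr (Or.inr (by nlinarith))
  · exact Or.inl (by simp)
  · have : (1 : ℝ) ≤ k := by exact_mod_cast h
    exact Or.inr (Or.inl (by nlinarith))

theorem isClosed_range_intCast_mul_sub {P : ℝ} (hP : 0 < P) (c : ℝ) :
    IsClosed (range fun n : ℤ => n * P - c) := by
  have h : (range fun n : ℤ => n * P - c) = (fun x : ℝ => (x + c) / P) ⁻¹' range Int.cast := by
    ext x
    simp only [mem_range, mem_preimage]
    refine exists_congr fun n => ?_
    rw [eq_div_iff hP.ne']
    exact sub_eq_iff_eq_add
  rw [h]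
  exact Int.isClosedEmbedding_coe_real.isClosed_range.preimage (by fun_prop)

/-- The corners of `ubar Λ δ`. -/
def ubarCorners (Λ δ : ℝ) : Set ℝ :=
  (range fun n : ℤ => n * ((Λ + 1) * δ) - 0) ∪ range fun n : ℤ => n * ((Λ + 1) * δ) - δ

theorem mem_Ioo_of_notMem_ubarCorners (hΛ : 0 < Λ) (hδ : 0 < δ) {x : ℝ}
    (hx : x ∉ ubarCorners Λ δ) :
    ∃ n : ℤ, x ∈ Ioo (n * ((Λ + 1) * δ) - δ) (n * ((Λ + 1) * δ)) ∨
      x ∈ Ioo (n * ((Λ + 1) * δ)) (n * ((Λ + 1) * δ) + Λ * δ) := by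
  obtain ⟨n, hn⟩ := exists_mem_Ico_ubar hΛ hδ x
  have h₁ : n * ((Λ + 1) * δ) - δ ≠ x := fun h => hx (Or.inr ⟨n, h⟩)
  have h₂ : n * ((Λ + 1) * δ) ≠ x := fun h => hx (Or.inl ⟨n, by simpa using h⟩)
  refine ⟨n, ?_⟩
  rcases lt_or_gt_of_ne h₂ with h | h
  · exact Or.inr ⟨h, hn.2⟩
  · exact Or.inl ⟨lt_of_le_of_ne hn.1 h₁, h⟩

theorem piecewiseAffine_ubar_sub (hΛ : 0 < Λ) (hδ : 0 < δ) (c : ℝ) :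
    PiecewiseAffine fun x => ubar Λ δ x - c := by
  have hP : 0 < (Λ + 1) * δ := by positivity
  have hΛδ : 0 < Λ * δ := by positivity
  refine ⟨ubarCorners Λ δ, (isClosed_range_intCast_mul_sub hP 0).union
    (isClosed_range_intCast_mul_sub hP δ), fun x hx => ?_, fun x hx => ?_⟩
  · refine ⟨min δ (Λ * δ), lt_min hδ hΛδ, fun z ⟨hz, hz₁, hz₂⟩ => mem_singleton_iff.2 ?_⟩
    have hε₁ := min_le_left δ (Λ * δ)
    have hε₂ := min_le_right δ (Λ * δ)
    rcases hx with ⟨n, rfl⟩ | ⟨n, rfl⟩ <;> rcases hz with ⟨m, rfl⟩ | ⟨m, rfl⟩ <;>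
    · have hk := intCast_mul_eq_zero_or_le_or_le_neg hP (m - n)
      push_cast at hk
      rcases hk with h | h | h <;> simp only at hz₁ hz₂ ⊢ <;> linarith
  · obtain ⟨n, h | h⟩ := mem_Ioo_of_notMem_ubarCorners hΛ hδ hx
    · obtain ⟨ε, hε, hball⟩ := Metric.isOpen_iff.1 isOpen_Ioo x h
      refine ⟨ε, hε, -Λ, Λ * (n * ((Λ + 1) * δ)) - c, fun y hy => ?_⟩
      beta_reduce
      rw [ubar_eq_left hΛ hδ n (Ioo_subset_Icc_self
        (hball (by rwa [Metric.mem_ball, Real.dist_eq])))]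
      ring
    · obtain ⟨ε, hε, hball⟩ := Metric.isOpen_iff.1 isOpen_Ioo x h
      refine ⟨ε, hε, 1, -(n * ((Λ + 1) * δ)) - c, fun y hy => ?_⟩
      beta_reduce
      rw [ubar_eq_right hΛ hδ n (Ioo_subset_Ico_self
        (hball (by rwa [Metric.mem_ball, Real.dist_eq])))]
      ring

theorem periodic_ubar (hΛ : 0 < Λ) (hδ : 0 < δ) (L : ℕ) :
    Function.Periodic (ubar Λ δ) (L * ((Λ + 1) * δ)) := by
  intro x
  have hP : 0 < (Λ + 1) * δ := by positivity
  have h : (x + L * ((Λ + 1) * δ) + δ) / ((Λ + 1) * δ) = (x + δ) / ((Λ + 1) * δ) + L := by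
    field_simp
    ring
  simp only [ubar, h, Int.fract_add_natCast]

theorem isNegFamily_ubar_sub (hΛ : 0 < Λ) (hδ : 0 < δ) (c : ℝ) :
    IsNegFamily Λ δ (fun x => ubar Λ δ x - c)
      fun k => Equiv.intEquivNat.symm k * ((Λ + 1) * δ) - δ where
  sub k x hx := (hasDerivAt_ubar_left hΛ hδ (Equiv.intEquivNat.symm k)
    ⟨hx.1, by linarith [hx.2]⟩).sub_const c
  cover x hx := by
    obtain ⟨n, hn⟩ := exists_mem_Ico_ubar hΛ hδ x
    refine mem_iUnion.2 ⟨Equiv.intEquivNat n, ?_⟩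
    rw [Equiv.symm_apply_apply]
    refine ⟨hn.1, ?_⟩
    by_contra! h
    have h₁ := (hasDerivAt_ubar_right hΛ hδ n ⟨by linarith, hn.2⟩).sub_const c
    linarith [h₁.unique hx]
  disj i j hij := by
    have hP : 0 < (Λ + 1) * δ := by positivity
    have hΛδ : 0 < Λ * δ := by positivity
    have hne := sub_ne_zero.2 (Equiv.intEquivNat.symm.injective.ne hij)
    rintro y ⟨hyi, hyj⟩
    exfalso
    have hk := intCast_mul_eq_zero_or_le_or_le_neg hP
      (Equiv.intEquivNat.symm i - Equiv.intEquivNat.symm j)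
    rcases hk with h | h | h
    · exact mul_ne_zero (Int.cast_ne_zero.2 hne) hP.ne' h
    · push_cast at h
      linarith [hyi.1, hyj.2]
    · push_cast at h
      linarith [hyi.2, hyj.1]

theorem admissible_ubar_sub (hΛ : 0 < Λ) (hδ : 0 < δ) (L : ℕ) (c : ℝ) :
    Admissible (L * ((Λ + 1) * δ)) Λ δ fun x => ubar Λ δ x - c where
  cont := (continuous_ubar hΛ hδ).sub continuous_const
  per x := by simp only [periodic_ubar hΛ hδ L x]
  pwAffine := piecewiseAffine_ubar_sub hΛ hδ c
  slopes := by
    have hc : (ubarCorners Λ δ).Countable := (countable_range _).union (countable_range _)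
    filter_upwards [hc.ae_notMem volume] with x hx
    obtain ⟨n, h | h⟩ := mem_Ioo_of_notMem_ubarCorners hΛ hδ hx
    · exact Or.inr ((hasDerivAt_ubar_left hΛ hδ n h).sub_const c)
    · exact Or.inl ((hasDerivAt_ubar_right hΛ hδ n h).sub_const c)
  negRegion :=
    have h := isNegFamily_ubar_sub hΛ hδ c
    ⟨_, h.sub, h.cover, h.disj⟩

end Ubar

/-- Every function with optimal values at the left ends of the intervals of its family is a
translate of `ubar`. -/
theorem IsNegFamily.eq_ubar {Λ δ T : ℝ} {u : ℝ → ℝ} {a : ℕ → ℝ} (ha : IsNegFamily Λ δ u a)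
    (hu : Admissible T Λ δ u) (hΛ : 0 < Λ) (hδ : 0 < δ) {L : ℕ} (hL : 0 < L)
    (hT : T = L * ((Λ + 1) * δ)) (hval : ∀ k, u (a k) = Λ * δ / 2) :
    u = fun x => ubar Λ δ (x - (a 0 + δ)) - Λ * δ / 2 := by
  have hP : 0 < (Λ + 1) * δ := by positivity
  have hTpos : 0 < T := by
    rw [hT]
    positivity
  have key : ∀ x ≥ a 0, u x = ubar Λ δ (x - (a 0 + δ)) - Λ * δ / 2 := by
    intro x hx
    set n := ⌊(x - a 0) / ((Λ + 1) * δ)⌋₊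
    have hn₁ : n * ((Λ + 1) * δ) ≤ x - a 0 :=
      (le_div_iff₀ hP).1 (Nat.floor_le (div_nonneg (by linarith) hP.le))
    have hn₂ : x - a 0 < (n + 1) * ((Λ + 1) * δ) :=
      (div_lt_iff₀ hP).1 (Nat.lt_floor_add_one _)
    obtain ⟨j, hj⟩ := ha.exists_add_mul hu hΛ hδ hval hTpos 0 n
    rcases le_or_gt x (a j + δ) with h | h
    · rw [ubar_eq_left hΛ hδ n ⟨by push_cast; linarith, by push_cast; linarith⟩,
        ha.eqOn hu.cont j ⟨by linarith, h⟩, hval j, hj]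
      push_cast
      ring
    · rw [ubar_eq_right hΛ hδ n ⟨by push_cast; linarith, by push_cast; linarith⟩,
        ha.eq_of_mem_rise hu hΛ hδ hval j ⟨h.le, by linarith⟩, hj]
      push_cast
      ring
  funext x
  obtain ⟨m, hm, -⟩ := existsUnique_add_zsmul_mem_Ico hTpos x (a 0)
  have h := key _ hm.1
  rwa [hu.per.zsmul m x, add_sub_right_comm,
    (hT ▸ periodic_ubar hΛ hδ L : Function.Periodic (ubar Λ δ) T).zsmul m] at h

/-- the minimizers of `ℱ^T_0` over `𝒜^{T,Λ,δ}` are exactly the functions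
`ū(· - x₀) - Λδ/2`. -/
theorem statement6 (Λ δ T : ℝ) (L : ℕ)
    (hΛ : 0 < Λ) (hδ : 0 < δ) (hL : 0 < L)
    (hT : T = (L : ℝ) * ((Λ + 1) * δ))
    (u : ℝ → ℝ) (hu : Admissible T Λ δ u) :
    (∀ v : ℝ → ℝ, Admissible T Λ δ v → F0 T u ≤ F0 T v) ↔
      ∃ x₀ : ℝ, u = fun x => ubar Λ δ (x - x₀) - Λ * δ / 2 := by
  have hTpos : 0 < T := by
    rw [hT]
    positivity
  obtain ⟨a, hsub, hcover, hdisj⟩ := hu.negRegion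
  have ha : IsNegFamily Λ δ u a := ⟨hsub, hcover, hdisj⟩
  have translate_iff : F0 T u = Λ ^ 2 * δ ^ 2 / 24 ↔
      ∃ x₀ : ℝ, u = fun x => ubar Λ δ (x - x₀) - Λ * δ / 2 := by
    rw [ha.F0_eq_iff hu hΛ hδ hTpos]
    refine ⟨fun hval => ⟨_, ha.eq_ubar hu hΛ hδ hL hT hval⟩, ?_⟩
    rintro ⟨x₀, hx₀⟩ k
    have h := ha.eqOn hu.cont k (x := a k + δ) ⟨by linarith, le_rfl⟩
    have h₁ := (ubar_mem_Icc hΛ hδ (a k - x₀)).2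
    have h₂ := (ubar_mem_Icc hΛ hδ (a k + δ - x₀)).1
    have hk := congrFun hx₀ (a k)
    have hk' := congrFun hx₀ (a k + δ)
    linarith
  rw [← translate_iff]
  constructor
  · intro hmin
    refine le_antisymm ?_ (ha.le_F0 hu hΛ hδ hTpos)
    have hw := admissible_ubar_sub hΛ hδ L (Λ * δ / 2)
    have hwa := isNegFamily_ubar_sub hΛ hδ (Λ * δ / 2)
    rw [← hT] at hw
    refine (hmin _ hw).trans_eq ((hwa.F0_eq_iff hw hΛ hδ hTpos).2 fun k => ?_)
    rw [ubar_eq_left hΛ hδ (Equiv.intEquivNat.symm k) ⟨le_rfl, by linarith⟩]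
    ring
  · intro h v hv
    obtain ⟨b, hsub', hcover', hdisj'⟩ := hv.negRegion
    rw [h]
    exact IsNegFamily.le_F0 ⟨hsub', hcover', hdisj'⟩ hv hΛ hδ hTpos
end
end

section
/- Let 0 < s < 1, T > 0, and let u, v: ℝ → ℝ be T-periodic, Lipschitz continuous, piecewise affine functions with v ≤ u on ℝ and v = u on a nondegenerate bounded interval I. Then ∫_I (−Δ)^s v(x) dx ≥ ∫_I (−Δ)^s u(x) dx, and equality holds if and only if u ≡ v on ℝ. -/
open MeasureTheory Filter Set Topology

noncomputable section

/-- The symmetrized integrand of the fractional Laplacian, as a function of the distance `t`. -/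
def symmDiffQuot (s : ℝ) (u : ℝ → ℝ) (x t : ℝ) : ℝ :=
  (2 * u x - u (x + t) - u (x - t)) / t ^ (1 + 2 * s)

/-- A closed set all of whose points are isolated meets compact intervals in finite sets. -/
lemma finite_inter_Icc_of_isolated {S : Set ℝ} (hS : IsClosed S)
    (hiso : ∀ x ∈ S, ∃ ε > 0, S ∩ Ioo (x - ε) (x + ε) ⊆ {x}) (a b : ℝ) :
    (S ∩ Icc a b).Finite := by
  have hc : IsCompact (S ∩ Icc a b) := isCompact_Icc.inter_left hS
  choose! ε hε hsub using hiso
  obtain ⟨t, ht, hcov⟩ := hc.elim_nhds_subcover (fun x => Ioo (x - ε x) (x + ε x))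
    (fun x hx => Ioo_mem_nhds (by linarith [hε x hx.1]) (by linarith [hε x hx.1]))
  refine t.finite_toSet.subset fun y hy => ?_
  obtain ⟨x, hx, hyx⟩ := mem_iUnion₂.1 (hcov hy)
  have := hsub x (ht x hx).1 ⟨hy.1, hyx⟩
  rw [mem_singleton_iff] at this
  exact this ▸ hx

/-- A function which is locally affine on an open interval is affine there. -/
lemma exists_affine_of_locally_affine {u : ℝ → ℝ} {p q : ℝ}
    (h : ∀ x ∈ Ioo p q, ∃ ε > 0, ∃ m k : ℝ, ∀ y : ℝ, |y - x| < ε → u y = m * y + k) :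
    ∃ m k : ℝ, ∀ y ∈ Ioo p q, u y = m * y + k := by
  rcases (Ioo p q).eq_empty_or_nonempty with he | ⟨x₀, hx₀⟩
  · exact ⟨0, 0, by simp [he]⟩
  have hloc : ∀ x ∈ Ioo p q, ∃ m : ℝ, ∀ᶠ y in 𝓝 x, HasDerivAt u m y := by
    intro x hx
    obtain ⟨ε, hε, m, k, hm⟩ := h x hx
    have hev : ∀ᶠ y in 𝓝 x, u y = m * y + k := by
      filter_upwards [Metric.ball_mem_nhds x hε] with y hy
      exact hm y (by simpa [Real.dist_eq] using hy)
    refine ⟨m, hev.eventually_nhds.mono fun y hy => ?_⟩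
    have h1 : HasDerivAt (fun y : ℝ => m * y + k) m y := by
      simpa using ((hasDerivAt_id y).const_mul m).add_const k
    exact h1.congr_of_eventuallyEq hy
  have hdd : ∀ x ∈ Ioo p q, HasDerivAt (deriv u) 0 x := by
    intro x hx
    obtain ⟨m, hm⟩ := hloc x hx
    exact (hasDerivAt_const x m).congr_of_eventuallyEq (hm.mono fun y hy => hy.deriv)
  have hconst : ∀ x ∈ Ioo p q, deriv u x = deriv u x₀ := fun x hx =>
    isOpen_Ioo.is_const_of_deriv_eq_zero isPreconnected_Ioo
      (fun y hy => (hdd y hy).differentiableAt.differentiableWithinAt)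
      (fun y hy => (hdd y hy).deriv) hx hx₀
  have hline : ∀ y : ℝ, HasDerivAt (fun y : ℝ => deriv u x₀ * y + (u x₀ - deriv u x₀ * x₀))
      (deriv u x₀) y := fun y => by
    simpa using ((hasDerivAt_id y).const_mul (deriv u x₀)).add_const (u x₀ - deriv u x₀ * x₀)
  refine ⟨deriv u x₀, u x₀ - deriv u x₀ * x₀, fun y hy => ?_⟩
  refine isOpen_Ioo.eqOn_of_deriv_eq isPreconnected_Ioo (fun z hz => ?_)
    (fun z _ => (hline z).differentiableAt.differentiableWithinAt)
    (fun z hz => (hconst z hz).trans (hline z).deriv.symm) hx₀ (by ring) hy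
  obtain ⟨m, hm⟩ := hloc z hz
  exact hm.self_of_nhds.differentiableAt.differentiableWithinAt

lemma integrable_indicator_Ioc_rpow_neg {s : ℝ} (hs1 : s < 1) {R : ℝ} (hR : 0 ≤ R) :
    Integrable ((Ioc 0 R).indicator fun t : ℝ => t ^ (-s)) := by
  rw [integrable_indicator_iff measurableSet_Ioc, ← intervalIntegrable_iff_integrableOn_Ioc_of_le hR]
  exact intervalIntegral.intervalIntegrable_rpow' (by linarith)

lemma integrable_indicator_Ici_rpow_neg {p : ℝ} (hp : 1 < p) {r : ℝ} (hr : 0 < r) :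
    Integrable ((Ici r).indicator fun t : ℝ => t ^ (-p)) := by
  rw [integrable_indicator_iff measurableSet_Ici]
  exact (integrableOn_Ioi_rpow_of_lt (by linarith) (half_pos hr)).mono_set
    (fun t ht => lt_of_lt_of_le (half_lt_self hr) ht)

lemma integrableOn_abs_sub_rpow_neg {s : ℝ} (hs : 0 < s) (hs1 : s < 1) (a b c : ℝ) :
    IntegrableOn (fun x : ℝ => |x - c| ^ (-s)) (Ioo a b) := by
  set R := |a| + |b| + |c| with hRdef
  have hR : 0 ≤ R := by positivity
  have h := integrable_indicator_Ioc_rpow_neg hs1 hR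
  refine ((h.add h.comp_neg).comp_sub_right c).integrableOn.congr_fun ?_ measurableSet_Ioo
  intro x hx
  have h1 : |x - c| ≤ R := by
    rw [abs_le]
    constructor <;> linarith [hx.1, hx.2, neg_abs_le a, le_abs_self b, neg_abs_le c,
      le_abs_self c, abs_nonneg a, abs_nonneg b]
  rw [abs_le] at h1
  rcases lt_trichotomy (x - c) 0 with h0 | h0 | h0
  · simp [indicator, h0, abs_of_neg h0, h0.not_gt, show c - x ≤ R by linarith]
  · simp [h0, Real.zero_rpow (neg_ne_zero.2 hs.ne')]
  · simp [indicator, h0, abs_of_pos h0, h1.2, show ¬ x < c by linarith]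

/-- Pointwise domination of the symmetrized integrand for a bounded Lipschitz piecewise affine
function, by a bound integrable in both variables. -/
lemma norm_symmDiffQuot_le {s : ℝ} (hs : 0 < s) {u : ℝ → ℝ} {K : NNReal}
    (hK : LipschitzWith K u) {M : ℝ} (hM : ∀ x, |u x| ≤ M) {S : Set ℝ}
    (hloc : ∀ x ∉ S, ∃ ε > 0, ∃ m q : ℝ, ∀ y : ℝ, |y - x| < ε → u y = m * y + q)
    {a b : ℝ} {P : Finset ℝ} (hP : S ∩ Icc (a - 2) (b + 2) ⊆ P)
    {x : ℝ} (hx : x ∈ Ioo a b) (hxS : x ∉ S) {t : ℝ} (ht : 0 < t) :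
    ‖symmDiffQuot s u x t‖ ≤
      (2 * K * 2 ^ s * ∑ c ∈ P, |x - c| ^ (-s)) * (Ioc 0 1).indicator (fun t : ℝ => t ^ (-s)) t
        + 4 * M * (Ici 1).indicator (fun t : ℝ => t ^ (-(1 + 2 * s))) t := by
  have hM0 : 0 ≤ M := (abs_nonneg _).trans (hM 0)
  have hD : 0 ≤ ∑ c ∈ P, |x - c| ^ (-s) := Finset.sum_nonneg fun c _ => by positivity
  have hφ : 0 ≤ (Ioc 0 1).indicator (fun t : ℝ => t ^ (-s)) t :=
    indicator_nonneg (fun y hy => Real.rpow_nonneg hy.1.le _) t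
  have hψ : 0 ≤ (Ici 1).indicator (fun t : ℝ => t ^ (-(1 + 2 * s))) t :=
    indicator_nonneg (fun y hy => Real.rpow_nonneg (zero_le_one.trans hy) _) t
  have hA : 0 ≤ (2 * K * 2 ^ s * ∑ c ∈ P, |x - c| ^ (-s)) *
      (Ioc 0 1).indicator (fun t : ℝ => t ^ (-s)) t := by positivity
  have hB : 0 ≤ 4 * M * (Ici 1).indicator (fun t : ℝ => t ^ (-(1 + 2 * s))) t := by positivity
  have htp : 0 < t ^ (1 + 2 * s) := Real.rpow_pos_of_pos ht _
  have hnorm : ‖symmDiffQuot s u x t‖ =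
      |2 * u x - u (x + t) - u (x - t)| * t ^ (-(1 + 2 * s)) := by
    rw [symmDiffQuot, Real.norm_eq_abs, abs_div, abs_of_pos htp, Real.rpow_neg ht.le, div_eq_mul_inv]
  have htn : 0 < t ^ (-(1 + 2 * s)) := Real.rpow_pos_of_pos ht _
  rcases le_or_gt 1 t with h1 | h1
  · refine le_trans ?_ (le_add_of_nonneg_left hA)
    rw [hnorm, indicator_of_mem (show t ∈ Ici 1 from h1)]
    refine mul_le_mul_of_nonneg_right ?_ htn.le
    have a1 := abs_le.1 (hM x)
    have a2 := abs_le.1 (hM (x + t))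
    have a3 := abs_le.1 (hM (x - t))
    rw [abs_le]
    constructor <;> linarith [a1.1, a1.2, a2.1, a2.2, a3.1, a3.2]
  · refine le_trans ?_ (le_add_of_nonneg_right hB)
    by_cases hex : ∃ c ∈ S, c ∈ Ioo (x - 2 * t) (x + 2 * t)
    · obtain ⟨c, hcS, hc⟩ := hex
      have hcP : c ∈ P := hP ⟨hcS, by linarith [hc.1, hx.1], by linarith [hc.2, hx.2]⟩
      have hxc : 0 < |x - c| := abs_pos.2 (sub_ne_zero.2 fun h => hxS (h ▸ hcS))
      have hxct : |x - c| ≤ 2 * t := by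
        rw [abs_le]
        constructor <;> linarith [hc.1, hc.2]
      have hlip : |2 * u x - u (x + t) - u (x - t)| ≤ 2 * K * t := by
        have b1 := abs_le.1 (hK.dist_le_mul x (x + t))
        have b2 := abs_le.1 (hK.dist_le_mul x (x - t))
        rw [Real.dist_eq, show x - (x + t) = -t by ring, abs_neg, abs_of_pos ht] at b1
        rw [Real.dist_eq, show x - (x - t) = t by ring, abs_of_pos ht] at b2
        rw [abs_le]
        constructor <;> linarith [b1.1, b1.2, b2.1, b2.2]
      have hpow : t ^ (-s) ≤ 2 ^ s * ∑ c ∈ P, |x - c| ^ (-s) := by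
        have h2 : (2 * t) ^ (-s) ≤ |x - c| ^ (-s) :=
          Real.rpow_le_rpow_of_nonpos hxc hxct (by linarith)
        have h3 : |x - c| ^ (-s) ≤ ∑ c ∈ P, |x - c| ^ (-s) :=
          Finset.single_le_sum (f := fun c => |x - c| ^ (-s))
            (fun c _ => Real.rpow_nonneg (abs_nonneg _) _) hcP
        have h4 : t ^ (-s) = 2 ^ s * (2 * t) ^ (-s) := by
          rw [Real.mul_rpow zero_le_two ht.le, ← mul_assoc, ← Real.rpow_add zero_lt_two]
          simp
        rw [h4]
        exact mul_le_mul_of_nonneg_left (h2.trans h3) (by positivity)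
      rw [hnorm, indicator_of_mem (show t ∈ Ioc 0 1 from ⟨ht, h1.le⟩)]
      calc |2 * u x - u (x + t) - u (x - t)| * t ^ (-(1 + 2 * s))
          ≤ (2 * K * t) * t ^ (-(1 + 2 * s)) := mul_le_mul_of_nonneg_right hlip htn.le
        _ = 2 * K * (t ^ (-s) * t ^ (-s)) := by
          rw [← Real.rpow_add ht, mul_assoc, ← Real.rpow_one_add' ht.le (by linarith)]
          ring_nf
        _ ≤ 2 * K * ((2 ^ s * ∑ c ∈ P, |x - c| ^ (-s)) * t ^ (-s)) := by gcongr
        _ = _ := by ring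
    · push Not at hex
      obtain ⟨m, k, hmk⟩ := exists_affine_of_locally_affine (u := u) (p := x - 2 * t)
        (q := x + 2 * t) (fun y hy => hloc y fun hyS => hex y hyS hy)
      have : 2 * u x - u (x + t) - u (x - t) = 0 := by
        rw [hmk x ⟨by linarith, by linarith⟩, hmk (x + t) ⟨by linarith, by linarith⟩,
          hmk (x - t) ⟨by linarith, by linarith⟩]
        ring
      rw [hnorm, this, abs_zero, zero_mul]
      exact hA

/-- The truncated singular integral in terms of the symmetrized integrand. -/
lemma integral_truncated_eq {s : ℝ} (hs : 0 < s) {u : ℝ → ℝ} (hu : Continuous u) {M : ℝ}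
    (hM : ∀ x, |u x| ≤ M) (x : ℝ) {r : ℝ} (hr : 0 < r) :
    ∫ y in {y : ℝ | r ≤ |x - y|}, (u x - u y) / |x - y| ^ (1 + 2 * s) =
      ∫ t in Ioi 0, (Ici r).indicator (symmDiffQuot s u x) t := by
  set h : ℝ → ℝ := {t : ℝ | r ≤ |t|}.indicator fun t => (u x - u (x + t)) / |t| ^ (1 + 2 * s)
    with hh
  have hmeas : ∀ z : ℝ, MeasurableSet {y : ℝ | r ≤ |z - y|} := fun z =>
    measurableSet_le measurable_const (by fun_prop)
  have hmeas' : MeasurableSet {t : ℝ | r ≤ |t|} := measurableSet_le measurable_const (by fun_prop)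
  have hhm : Measurable h := by
    refine Measurable.indicator ?_ hmeas'
    have := hu.measurable
    fun_prop
  have hφ := integrable_indicator_Ici_rpow_neg (p := 1 + 2 * s) (by linarith) hr
  have hint : Integrable h := by
    refine ((hφ.add hφ.comp_neg).const_mul (2 * M)).mono' hhm.aestronglyMeasurable
      (Eventually.of_forall fun t => ?_)
    have hM0 : 0 ≤ M := (abs_nonneg _).trans (hM 0)
    have hnn : ∀ t, 0 ≤ (Ici r).indicator (fun t : ℝ => t ^ (-(1 + 2 * s))) t := fun t =>
      indicator_nonneg (fun y hy => Real.rpow_nonneg (hr.le.trans hy) _) t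
    by_cases ht : r ≤ |t|
    · have hpos : 0 < |t| := hr.trans_le ht
      have key : |t| ^ (-(1 + 2 * s)) ≤ (Ici r).indicator (fun t : ℝ => t ^ (-(1 + 2 * s))) t +
          (Ici r).indicator (fun t : ℝ => t ^ (-(1 + 2 * s))) (-t) := by
        rcases abs_choice t with h0 | h0
        · rw [h0] at ht ⊢
          rw [indicator_of_mem (show t ∈ Ici r from ht)]
          exact le_add_of_nonneg_right (hnn _)
        · rw [h0] at ht ⊢
          rw [indicator_of_mem (show -t ∈ Ici r from ht)]
          exact le_add_of_nonneg_left (hnn _)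
      rw [hh, indicator_of_mem (show t ∈ {t : ℝ | r ≤ |t|} from ht), Real.norm_eq_abs, abs_div,
        abs_of_pos (Real.rpow_pos_of_pos hpos _), div_eq_mul_inv, ← Real.rpow_neg hpos.le]
      refine mul_le_mul ?_ key (Real.rpow_nonneg hpos.le _) (by positivity)
      have a1 := abs_le.1 (hM x)
      have a2 := abs_le.1 (hM (x + t))
      rw [abs_le]
      constructor <;> linarith [a1.1, a1.2, a2.1, a2.2]
    · rw [hh, indicator_of_notMem (show t ∉ {t : ℝ | r ≤ |t|} from ht), norm_zero]
      exact mul_nonneg (by positivity) (add_nonneg (hnn _) (hnn _))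
  have h1 : ∫ y in {y : ℝ | r ≤ |x - y|}, (u x - u y) / |x - y| ^ (1 + 2 * s) = ∫ t, h t := by
    rw [← integral_indicator (hmeas x), ← integral_add_left_eq_self _ x]
    refine integral_congr_ae (Eventually.of_forall fun t => ?_)
    simp [hh, indicator]
  rw [h1, ← intervalIntegral.integral_Iic_add_Ioi (b := 0) hint.integrableOn hint.integrableOn]
  have h2 := integral_comp_neg_Ioi 0 h
  rw [neg_zero] at h2
  rw [← h2, ← integral_add hint.comp_neg.integrableOn hint.integrableOn]
  refine setIntegral_congr_fun measurableSet_Ioi fun t ht => ?_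
  rw [mem_Ioi] at ht
  by_cases htr : r ≤ t
  · simp only [hh, indicator, mem_ofPred_eq, abs_neg, abs_of_pos ht, htr, if_true, mem_Ici,
      symmDiffQuot, ← sub_eq_add_neg]
    ring
  · simp [hh, indicator, abs_of_pos ht, htr]

lemma stronglyMeasurable_symmDiffQuot (s : ℝ) {u : ℝ → ℝ} (hu : Continuous u) :
    StronglyMeasurable (Function.uncurry (symmDiffQuot s u)) := by
  refine Measurable.stronglyMeasurable ?_
  have := hu.measurable
  unfold symmDiffQuot Function.uncurry
  fun_prop

/-- The fractional Laplacian is the absolutely convergent symmetrized integral as soon as the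
latter converges absolutely. -/
lemma fracLap_eq_of_integrableOn {s : ℝ} (hs : 0 < s) {u : ℝ → ℝ} (hu : Continuous u) {M : ℝ}
    (hM : ∀ x, |u x| ≤ M) {x : ℝ} (hint : IntegrableOn (symmDiffQuot s u x) (Ioi 0)) :
    fracLap s u x = 2 * ∫ t in Ioi 0, symmDiffQuot s u x t := by
  refine Tendsto.limUnder_eq (Tendsto.const_mul 2 ?_)
  have : Tendsto (fun r : ℝ => ∫ t in Ioi 0, (Ici r).indicator (symmDiffQuot s u x) t)
      (𝓝[>] 0) (𝓝 (∫ t in Ioi 0, symmDiffQuot s u x t)) := by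
    refine tendsto_integral_filter_of_dominated_convergence (fun t => ‖symmDiffQuot s u x t‖)
      (Eventually.of_forall fun r => hint.aestronglyMeasurable.indicator measurableSet_Ici)
      (Eventually.of_forall fun r => Eventually.of_forall fun t => norm_indicator_le_norm_self _ _)
      hint.norm ?_
    filter_upwards [ae_restrict_mem measurableSet_Ioi] with t ht
    refine tendsto_const_nhds.congr' ?_
    filter_upwards [nhdsWithin_le_nhds (Iio_mem_nhds (show (0 : ℝ) < t from ht))] with r hr
    rw [indicator_of_mem (mem_Ici.2 (mem_Iio.1 hr).le)]
  refine this.congr' ?_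
  filter_upwards [self_mem_nhdsWithin] with r hr
  exact (integral_truncated_eq hs hu hM x hr).symm

/-- On a bounded interval, the fractional Laplacian of a bounded Lipschitz piecewise affine
function is a.e. given by the symmetrized integral, and it is integrable. -/
lemma fracLap_ae_eq_and_integrableOn {s : ℝ} (hs : 0 < s) (hs1 : s < 1) {u : ℝ → ℝ}
    (hlip : ∃ K : NNReal, LipschitzWith K u) {M : ℝ} (hM : ∀ x, |u x| ≤ M)
    (hpa : PiecewiseAffine u) (a b : ℝ) :
    (∀ᵐ x ∂volume.restrict (Ioo a b), IntegrableOn (symmDiffQuot s u x) (Ioi 0) ∧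
      fracLap s u x = 2 * ∫ t in Ioi 0, symmDiffQuot s u x t) ∧
    IntegrableOn (fracLap s u) (Ioo a b) := by
  obtain ⟨K, hK⟩ := hlip
  have hu := hK.continuous
  obtain ⟨S, hSc, hSi, hloc⟩ := hpa
  have hfin := finite_inter_Icc_of_isolated hSc hSi (a - 2) (b + 2)
  set P := hfin.toFinset with hPdef
  have hP : S ∩ Icc (a - 2) (b + 2) ⊆ P := by simp [hPdef]
  set φ : ℝ → ℝ := (Ioc 0 1).indicator fun t : ℝ => t ^ (-s) with hφdef
  set ψ : ℝ → ℝ := (Ici 1).indicator fun t : ℝ => t ^ (-(1 + 2 * s)) with hψdef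
  have hφ : Integrable φ := integrable_indicator_Ioc_rpow_neg hs1 zero_le_one
  have hψ : Integrable ψ := integrable_indicator_Ici_rpow_neg (by linarith) zero_lt_one
  set D : ℝ → ℝ := fun x => 2 * K * 2 ^ s * ∑ c ∈ P, |x - c| ^ (-s) with hDdef
  have hD : IntegrableOn D (Ioo a b) :=
    (integrable_finsetSum P fun c _ => integrableOn_abs_sub_rpow_neg hs hs1 a b c).const_mul _
  have hmeas := stronglyMeasurable_symmDiffQuot s hu
  have hbd : ∀ x ∈ Ioo a b, x ∉ S → ∀ᵐ t ∂volume.restrict (Ioi (0 : ℝ)),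
      ‖symmDiffQuot s u x t‖ ≤ D x * φ t + 4 * M * ψ t := by
    intro x hx hxS
    filter_upwards [ae_restrict_mem measurableSet_Ioi] with t ht
    exact norm_symmDiffQuot_le hs hK hM hloc hP hx hxS ht
  have hbdi : ∀ x, Integrable (fun t => D x * φ t + 4 * M * ψ t) (volume.restrict (Ioi 0)) :=
    fun x => ((hφ.const_mul _).add (hψ.const_mul _)).integrableOn
  have hx_good : ∀ᵐ x ∂volume.restrict (Ioo a b), x ∈ Ioo a b ∧ x ∉ S := by
    have h0 : ∀ᵐ x ∂volume.restrict (Ioo a b), x ∉ (P : Set ℝ) :=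
      ae_restrict_of_ae (measure_eq_zero_iff_ae_notMem.1 (P.finite_toSet.measure_zero volume))
    filter_upwards [ae_restrict_mem measurableSet_Ioo, h0] with x hx hxP
    exact ⟨hx, fun hxS => hxP (hP ⟨hxS, by linarith [hx.1], by linarith [hx.2]⟩)⟩
  have hmain : ∀ᵐ x ∂volume.restrict (Ioo a b), IntegrableOn (symmDiffQuot s u x) (Ioi 0) ∧
      fracLap s u x = 2 * ∫ t in Ioi 0, symmDiffQuot s u x t := by
    filter_upwards [hx_good] with x hx
    have hi : IntegrableOn (symmDiffQuot s u x) (Ioi 0) :=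
      (hbdi x).mono' (hmeas.comp_measurable measurable_prodMk_left).aestronglyMeasurable
        (hbd x hx.1 hx.2)
    exact ⟨hi, fracLap_eq_of_integrableOn hs hu hM hi⟩
  refine ⟨hmain, ?_⟩
  have hF : IntegrableOn (fun x => 2 * ∫ t in Ioi 0, symmDiffQuot s u x t) (Ioo a b) := by
    refine Integrable.const_mul ?_ 2
    refine Integrable.mono' (g := fun x => D x * (∫ t in Ioi 0, φ t) + 4 * M * ∫ t in Ioi 0, ψ t)
      ((hD.mul_const _).add (integrableOn_const (by simp)))
      hmeas.integral_prod_right.aestronglyMeasurable ?_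
    filter_upwards [hx_good] with x hx
    calc ‖∫ t in Ioi 0, symmDiffQuot s u x t‖
        ≤ ∫ t in Ioi 0, (D x * φ t + 4 * M * ψ t) :=
          norm_integral_le_of_norm_le (hbdi x) (hbd x hx.1 hx.2)
      _ = _ := by
        rw [integral_add (hφ.const_mul _).integrableOn (hψ.const_mul _).integrableOn,
          integral_const_mul, integral_const_mul]
  exact hF.congr (hmain.mono fun x hx => hx.2.symm)

/-- comparison principle for averages of the fractional Laplacian.
If `v ≤ u` everywhere and `v = u` on a nondegenerate bounded interval `I = (a,b)`, then
`∫_I (-Δ)^s v ≥ ∫_I (-Δ)^s u`, with equality iff `u ≡ v`. -/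
theorem statement12 (s T a b : ℝ) (hs : 0 < s) (hs1 : s < 1) (hT : 0 < T) (hab : a < b)
    (u v : ℝ → ℝ)
    (hu_per : Function.Periodic u T) (hv_per : Function.Periodic v T)
    (hu_lip : ∃ K : NNReal, LipschitzWith K u) (hv_lip : ∃ K : NNReal, LipschitzWith K v)
    (hu_pa : PiecewiseAffine u) (hv_pa : PiecewiseAffine v)
    (hle : ∀ x : ℝ, v x ≤ u x) (heq : ∀ x ∈ Set.Ioo a b, v x = u x) :
    (∫ x in Set.Ioo a b, fracLap s u x) ≤ (∫ x in Set.Ioo a b, fracLap s v x) ∧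
    ((∫ x in Set.Ioo a b, fracLap s v x) = (∫ x in Set.Ioo a b, fracLap s u x) ↔ u = v) := by
  have hbdd : ∀ w : ℝ → ℝ, Function.Periodic w T → (∃ K : NNReal, LipschitzWith K w) →
      ∃ M, ∀ x, |w x| ≤ M := by
    rintro w hw ⟨K, hK⟩
    obtain ⟨M, hM⟩ :=
      (hw.isBounded_of_continuous hT.ne' hK.continuous).exists_norm_le
    exact ⟨M, fun x => hM _ (mem_range_self x)⟩
  obtain ⟨Mu, hMu⟩ := hbdd u hu_per hu_lip
  obtain ⟨Mv, hMv⟩ := hbdd v hv_per hv_lip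
  obtain ⟨hu_ae, hu_int⟩ := fracLap_ae_eq_and_integrableOn hs hs1 hu_lip hMu hu_pa a b
  obtain ⟨hv_ae, hv_int⟩ := fracLap_ae_eq_and_integrableOn hs hs1 hv_lip hMv hv_pa a b
  have hquot : ∀ x ∈ Ioo a b, ∀ t, symmDiffQuot s v x t - symmDiffQuot s u x t =
      ((u (x + t) - v (x + t)) + (u (x - t) - v (x - t))) / t ^ (1 + 2 * s) := by
    intro x hx t
    simp only [symmDiffQuot, heq x hx]
    ring
  have hnonneg : ∀ x ∈ Ioo a b, ∀ t ∈ Ioi (0 : ℝ),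
      0 ≤ symmDiffQuot s v x t - symmDiffQuot s u x t := by
    intro x hx t ht
    rw [hquot x hx]
    exact div_nonneg (add_nonneg (sub_nonneg.2 (hle _)) (sub_nonneg.2 (hle _)))
      (Real.rpow_nonneg (le_of_lt ht) _)
  have hdiff : ∀ᵐ x ∂volume.restrict (Ioo a b), x ∈ Ioo a b ∧
      IntegrableOn (fun t => symmDiffQuot s v x t - symmDiffQuot s u x t) (Ioi 0) ∧
      fracLap s v x - fracLap s u x =
        2 * ∫ t in Ioi 0, (symmDiffQuot s v x t - symmDiffQuot s u x t) := by
    filter_upwards [hu_ae, hv_ae, ae_restrict_mem measurableSet_Ioo] with x hux hvx hx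
    refine ⟨hx, hvx.1.sub hux.1, ?_⟩
    rw [integral_sub hvx.1 hux.1, hvx.2, hux.2]
    ring
  have hdiff_nonneg : 0 ≤ᵐ[volume.restrict (Ioo a b)] fun x => fracLap s v x - fracLap s u x := by
    filter_upwards [hdiff] with x hx
    rw [hx.2.2]
    exact mul_nonneg zero_le_two (setIntegral_nonneg measurableSet_Ioi (hnonneg x hx.1))
  have hsub := integral_sub hv_int hu_int
  refine ⟨?_, fun h => ?_, fun h => by rw [h]⟩
  · have := integral_nonneg_of_ae hdiff_nonneg
    linarith
  rw [h, sub_self, integral_eq_zero_iff_of_nonneg_ae hdiff_nonneg (hv_int.sub hu_int)] at hsub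
  have : NeZero (volume.restrict (Ioo a b)) := ⟨by simp [Measure.restrict_eq_zero, hab]⟩
  obtain ⟨x, ⟨hxI, hxi, hxe⟩, hx0⟩ := (hdiff.and hsub).exists
  have hzero : ∫ t in Ioi 0, (symmDiffQuot s v x t - symmDiffQuot s u x t) = 0 := by
    have : fracLap s v x - fracLap s u x = 0 := hx0
    linarith
  have hcu : Continuous u := hu_lip.choose_spec.continuous
  have hcv : Continuous v := hv_lip.choose_spec.continuous
  rw [integral_eq_zero_iff_of_nonneg_ae
    ((ae_restrict_mem measurableSet_Ioi).mono (hnonneg x hxI)) hxi] at hzero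
  have hsum : EqOn (fun t => (u (x + t) - v (x + t)) + (u (x - t) - v (x - t))) 0 (Ioi 0) := by
    refine Measure.eqOn_open_of_ae_eq (μ := volume) ?_ isOpen_Ioi (by fun_prop) continuousOn_const
    filter_upwards [hzero, ae_restrict_mem measurableSet_Ioi] with t ht htpos
    rw [hquot x hxI] at ht
    exact (div_eq_zero_iff.1 ht).resolve_right (Real.rpow_pos_of_pos htpos _).ne'
  funext y
  rcases lt_trichotomy y x with hy | rfl | hy
  · have h1 := hsum (show x - y ∈ Ioi 0 from sub_pos.2 hy)
    simp only [Pi.zero_apply, sub_sub_cancel] at h1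
    linarith [hle y, hle (x + (x - y))]
  · exact (heq y hxI).symm
  · have h1 := hsum (show y - x ∈ Ioi 0 from sub_pos.2 hy)
    simp only [Pi.zero_apply, add_sub_cancel] at h1
    linarith [hle y, hle (x - (y - x))]
end
end
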